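/- Let G be a finite group, p a prime, N a normal subgroup of G of order prime to p, and A ∈ A_p(G) of rank at most 3; write Ā = AN/N ∈ A_p(G/N). Assume Aschbacher's conjecture at p holds for all instances of rank 3. Then the fundamental group of the geometric realization of K(A_p(AN) * A_p(G/N)^2_{>Ā}) is a free group if |A| = p or |A| = p², and is trivial if |A| = p³. -/

import Mathlib

open Function

/-- The geometric realization of the order complex of the subposet `S` of `X`,
realized as a subspace of `X → ℝ`: convex combinations supported on finite
nonempty chains contained in `S`. -/
def geomRealOn {X : Type*} [Preorder X] (S : Set X) : Set (X → ℝ) :=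
  {f | (∀ x, 0 ≤ f x) ∧ Function.support f ⊆ S ∧ IsChain (· ≤ ·) (Function.support f) ∧
    ∃ s : Finset X, Function.support f ⊆ ↑s ∧ ∑ x ∈ s, f x = 1}

/-- A group is elementary abelian for the prime `p` if it is abelian and
every element has order dividing `p`. -/
def IsElementaryAbelian (p : ℕ) (G : Type*) [Group G] : Prop :=
  (∀ a b : G, a * b = b * a) ∧ ∀ a : G, a ^ p = 1

/-- The Quillen poset `A_p(G)`: nontrivial elementary abelian `p`-subgroups of `G`. -/
def apSet (p : ℕ) (G : Type*) [Group G] : Set (Subgroup G) :=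
  {H | H ≠ ⊥ ∧ IsElementaryAbelian p ↥H}

/-- `Ω₁(G)`: the subgroup generated by the elements of order `p`. -/
def omega1 (p : ℕ) (G : Type*) [Group G] : Subgroup G :=
  Subgroup.closure {x : G | orderOf x = p}

/-- A group is almost simple if it has a nonabelian simple normal subgroup
with trivial centralizer. -/
def IsAlmostSimple (H : Type*) [Group H] : Prop :=
  ∃ L : Subgroup H, L.Normal ∧ IsSimpleGroup ↥L ∧ (∃ a b : ↥L, a * b ≠ b * a) ∧
    Subgroup.centralizer (L : Set H) = ⊥

/-- The conjugate subgroup `g L g⁻¹`. -/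
def conjSub {H : Type*} [Group H] (g : H) (L : Subgroup H) : Subgroup H :=
  L.map ((MulAut.conj g).toMonoidHom)

/-- `L` is a subnormal subgroup. -/
def IsSubnormal {H : Type*} [Group H] (L : Subgroup H) : Prop :=
  ∃ (n : ℕ) (c : ℕ → Subgroup H), c 0 = L ∧ c n = ⊤ ∧
    ∀ i < n, c i ≤ c (i + 1) ∧ ∀ g ∈ c (i + 1), ∀ x ∈ c i, g * x * g⁻¹ ∈ c i

/-- `N` is the internal direct product of the `A`-conjugates of `L`. -/
def IsDirectProdOfConjugates {H : Type*} [Group H] (A N L : Subgroup H) : Prop :=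
  (⨆ (K : Subgroup H) (_ : ∃ a ∈ A, K = conjSub a L), K) = N ∧
  (∀ K K' : Subgroup H, (∃ a ∈ A, K = conjSub a L) → (∃ a ∈ A, K' = conjSub a L) → K ≠ K' →
    ∀ x ∈ K, ∀ y ∈ K', x * y = y * x) ∧
  (∀ K : Subgroup H, (∃ a ∈ A, K = conjSub a L) →
    K ⊓ (⨆ (K' : Subgroup H) (_ : (∃ a ∈ A, K' = conjSub a L) ∧ K' ≠ K), K') = ⊥)

/-- The hypotheses of Aschbacher's conjecture (without the rank condition). -/
def AschbacherCore (p : ℕ) {H : Type*} [Group H] (A N L : Subgroup H) : Prop :=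
  IsElementaryAbelian p ↥A ∧ N.Normal ∧ Subgroup.centralizer (N : Set H) = ⊥ ∧
    A ⊔ N = ⊤ ∧ L ≤ N ∧ IsSubnormal L ∧ IsSimpleGroup ↥L ∧ (∃ a b : ↥L, a * b ≠ b * a) ∧
    ¬ p ∣ Nat.card ↥L ∧ IsDirectProdOfConjugates A N L


/-- Aschbacher's conjecture at `p`, restricted to instances of rank exactly 3. -/
def AschbacherConjectureRank3 (p : ℕ) : Prop :=
  ∀ (H : Type) [Group H] [Finite H] (A N L : Subgroup H),
    AschbacherCore p A N L → Nat.card ↥A = p ^ 3 →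
    SimplyConnectedSpace ↥(geomRealOn (apSet p H))

/-- The poset `A_p(K)` for a subgroup `K ≤ G`, realized inside the subgroup lattice
of `G`. -/
def apSetIn (p : ℕ) {G : Type*} [Group G] (K : Subgroup G) : Set (Subgroup G) :=
  {H | H ≠ ⊥ ∧ IsElementaryAbelian p ↥H ∧ H ≤ K}

/-- The truncated poset `A_p(G)ⁿ = {A ∈ A_p(G) : |A| ≤ p^(n+1)}`. -/
def apSetN (p : ℕ) (G : Type*) [Group G] (n : ℕ) : Set (Subgroup G) :=
  {H | H ∈ apSet p G ∧ Nat.card ↥H ≤ p ^ (n + 1)}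

/-- The join `A_p(BN) * A_p(G/N)²_{> b}`, as the lexicographic sum of the two posets. -/
abbrev quillenJoin (p : ℕ) (G : Type) [Group G] (N : Subgroup G) [N.Normal]
    (B : Subgroup G) (b : Subgroup (G ⧸ N)) : Type :=
  ↥(apSetIn p (B ⊔ N)) ⊕ₗ ↥{H : Subgroup (G ⧸ N) | H ∈ apSetN p (G ⧸ N) 2 ∧ b < H}

/-! ### Fundamental groups of spaces with a good cover -/

section

open Path.Homotopic (Quotient)

/-- A cover by simply connected open sets with path connected double intersections, in which
pairwise meeting triples have a common point. -/
structure GoodCover (K : Type) [TopologicalSpace K] (ι : Type) where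
  /-- The members of the cover. -/
  U : ι → Set K
  isOpen : ∀ i, IsOpen (U i)
  simplyConnected : ∀ i, IsSimplyConnected (U i)
  pathConnected : ∀ i j, (U i ∩ U j).Nonempty → IsPathConnected (U i ∩ U j)
  flag : ∀ i j k, (U i ∩ U j).Nonempty → (U j ∩ U k).Nonempty → (U i ∩ U k).Nonempty →
    (U i ∩ U j ∩ U k).Nonempty
  /-- A chosen member of the cover around each point. -/
  idx : K → ι
  mem_idx : ∀ f, f ∈ U (idx f)

namespace GoodCover

variable {K : Type} [TopologicalSpace K] {ι : Type} (𝒰 : GoodCover K ι)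

/-- Two members of the cover meet. -/
def Meet (i j : ι) : Prop := (𝒰.U i ∩ 𝒰.U j).Nonempty

/-- A 1-cocycle on the nerve of the cover. -/
def IsNerveCocycle {Γ : Type} [Group Γ] (c : ι → ι → Γ) : Prop :=
  ∀ i j k, 𝒰.Meet i j → 𝒰.Meet j k → 𝒰.Meet i k → c i k = c i j * c j k

theorem path_induction {P : ∀ {f g : K}, Quotient f g → Prop}
    (small : ∀ i {f g : K} (γ : Path f g), (∀ t, γ t ∈ 𝒰.U i) → P (Path.Homotopic.Quotient.mk γ))
    (trans : ∀ {f g h : K} (γ : Quotient f g) (η : Quotient g h), P γ → P η → P (γ.trans η))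
    {f g : K} (γ : Quotient f g) : P γ := by
  induction γ using Path.Homotopic.Quotient.ind with
  | mk γ =>
  obtain ⟨t, h0, hmono, ⟨n, hn⟩, hc⟩ := exists_monotone_Icc_subset_open_cover_unitInterval
    (c := fun i => γ ⁻¹' 𝒰.U i) (fun i => (𝒰.isOpen i).preimage γ.continuous)
    (fun s _ => Set.mem_iUnion.2 ⟨_, 𝒰.mem_idx (γ s)⟩)
  have key : ∀ m, P (Path.Homotopic.Quotient.mk (γ.subpath (t 0) (t m))) := by
    intro m
    induction m with
    | zero =>
      refine small (𝒰.idx (γ (t 0))) _ fun s => ?_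
      rw [Path.subpath_self]
      exact 𝒰.mem_idx _
    | succ m ih =>
      have : Path.Homotopic.Quotient.mk (γ.subpath (t 0) (t (m + 1))) =
          (Path.Homotopic.Quotient.mk (γ.subpath (t 0) (t m))).trans
            (Path.Homotopic.Quotient.mk (γ.subpath (t m) (t (m + 1)))) := by
        rw [← Path.Homotopic.Quotient.mk_trans, Path.Homotopic.Quotient.eq]
        exact ⟨(Path.Homotopy.subpathTransSubpath γ _ _ _).symm⟩
      rw [this]
      obtain ⟨i, hi⟩ := hc m
      refine trans _ _ ih (small i _ fun s => ?_)
      have hs : γ.subpath (t m) (t (m + 1)) s ∈ Set.range (γ.subpath (t m) (t (m + 1))) := ⟨s, rfl⟩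
      rw [Path.range_subpath_of_le _ _ _ (hmono (Nat.le_succ m))] at hs
      obtain ⟨r, hr, hrs⟩ := hs
      rw [← hrs]
      exact hi hr
  have h1 := key n
  rw [h0, hn n le_rfl, Path.subpath_zero_one] at h1
  have cast_mk : ∀ {a b a' b' : K} (p : Path a b) (ha : a' = a) (hb : b' = b),
      P (Path.Homotopic.Quotient.mk (p.cast ha hb)) → P (Path.Homotopic.Quotient.mk p) := by
    rintro a b _ _ p rfl rfl h
    exact h
  exact cast_mk _ _ _ h1

theorem homotopic_of_mem {i : ι} {f g : K} (γ η : Path f g) (hγ : ∀ t, γ t ∈ 𝒰.U i)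
    (hη : ∀ t, η t ∈ 𝒰.U i) : Path.Homotopic.Quotient.mk γ = Path.Homotopic.Quotient.mk η := by
  have : SimplyConnectedSpace (𝒰.U i) := 𝒰.simplyConnected i
  have hf : f ∈ 𝒰.U i := by simpa using hγ 0
  have hg : g ∈ 𝒰.U i := by simpa using hγ 1
  let γ' : Path (⟨f, hf⟩ : 𝒰.U i) ⟨g, hg⟩ :=
    ⟨⟨fun t => ⟨γ t, hγ t⟩, by fun_prop⟩, by simp, by simp⟩
  let η' : Path (⟨f, hf⟩ : 𝒰.U i) ⟨g, hg⟩ :=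
    ⟨⟨fun t => ⟨η t, hη t⟩, by fun_prop⟩, by simp, by simp⟩
  have := (SimplyConnectedSpace.paths_homotopic γ' η').map ⟨Subtype.val, continuous_subtype_val⟩
  exact Path.Homotopic.Quotient.eq.2 this

theorem exists_path_mem {i : ι} {f g : K} (hf : f ∈ 𝒰.U i) (hg : g ∈ 𝒰.U i) :
    ∃ γ : Path f g, ∀ t, γ t ∈ 𝒰.U i :=
  ((𝒰.simplyConnected i).isPathConnected.joinedIn f hf g hg)

theorem exists_path_mem_inter {i j : ι} {f g : K} (hf : f ∈ 𝒰.U i ∩ 𝒰.U j)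
    (hg : g ∈ 𝒰.U i ∩ 𝒰.U j) : ∃ γ : Path f g, ∀ t, γ t ∈ 𝒰.U i ∩ 𝒰.U j :=
  (𝒰.pathConnected i j ⟨f, hf⟩).joinedIn f hf g hg

variable {𝒰} in
theorem IsNerveCocycle.self {Γ : Type} [Group Γ] {c : ι → ι → Γ} (hc : 𝒰.IsNerveCocycle c)
    (i : ι) : c i i = 1 := by
  have hi : 𝒰.Meet i i := by
    obtain ⟨f, hf⟩ := (𝒰.simplyConnected i).nonempty
    exact ⟨f, hf, hf⟩
  simpa using hc i i i hi hi hi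

/-- The principal bundle with discrete fibre attached to a nerve cocycle. -/
@[reducible] noncomputable def bundle {Γ : Type} [Group Γ] [TopologicalSpace Γ]
    [DiscreteTopology Γ] (c : ι → ι → Γ) (hc : 𝒰.IsNerveCocycle c) : FiberBundleCore ι K Γ where
  baseSet := 𝒰.U
  isOpen_baseSet := 𝒰.isOpen
  indexAt := 𝒰.idx
  mem_baseSet_at := 𝒰.mem_idx
  coordChange i j _ v := v * c i j
  coordChange_self i f _ v := by simp [hc.self i]
  continuousOn_coordChange i j := by
    refine Continuous.continuousOn ?_
    exact (continuous_of_discreteTopology (f := fun v : Γ => v * c i j)).comp continuous_snd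
  coordChange_comp i j k f hf v := by
    obtain ⟨⟨hi, hj⟩, hk⟩ := hf
    rw [mul_assoc, hc i j k ⟨f, hi, hj⟩ ⟨f, hj, hk⟩ ⟨f, hi, hk⟩]

/-- Holonomy of a nerve cocycle along homotopy classes of paths. -/
theorem exists_holonomy {Γ : Type} [Group Γ] (c : ι → ι → Γ) (hc : 𝒰.IsNerveCocycle c) :
    ∃ hol : ∀ {f g : K}, Quotient f g → Γ,
      (∀ {f g h : K} (γ : Quotient f g) (η : Quotient g h),
        hol (γ.trans η) = hol γ * hol η) ∧
      ∀ i {f g : K} (γ : Path f g), (∀ t, γ t ∈ 𝒰.U i) →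
        hol (Path.Homotopic.Quotient.mk γ) = c (𝒰.idx f) i * c i (𝒰.idx g) := by
  let : TopologicalSpace Γ := ⊥
  have : DiscreteTopology Γ := ⟨rfl⟩
  let Z := 𝒰.bundle c hc
  have cov : IsCoveringMap (Bundle.TotalSpace.proj : Bundle.TotalSpace Γ Z.Fiber → K) :=
    FiberBundle.isCoveringMap
  let mon : ∀ {f g : K}, Quotient f g → Γ → Γ := fun {f g} γ a =>
    (cov.monodromy γ ⟨⟨f, a⟩, rfl⟩).1.2
  have mon_eq : ∀ {f g : K} (γ : Quotient f g) (a : Γ),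
      cov.monodromy γ ⟨⟨f, a⟩, rfl⟩ = ⟨⟨g, mon γ a⟩, rfl⟩ := by
    intro f g γ a
    apply Subtype.ext
    have h := (cov.monodromy γ ⟨⟨f, a⟩, rfl⟩).2
    simp only [mon]
    generalize (cov.monodromy γ ⟨⟨f, a⟩, rfl⟩).1 = e at h ⊢
    obtain ⟨e1, e2⟩ := e
    obtain rfl : e1 = g := h
    rfl
  have mon_trans : ∀ {f g h : K} (γ : Quotient f g) (η : Quotient g h) (a : Γ),
      mon (γ.trans η) a = mon η (mon γ a) := by
    intro f g h γ η a
    have := cov.monodromy_trans_apply γ η ⟨⟨f, a⟩, rfl⟩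
    rw [mon_eq γ, mon_eq η] at this
    simp only [mon] at this ⊢
    rw [this]
  have mon_small : ∀ i {f g : K} (γ : Path f g), (∀ t, γ t ∈ 𝒰.U i) → ∀ a,
      mon (Path.Homotopic.Quotient.mk γ) a = a * (c (𝒰.idx f) i * c i (𝒰.idx g)) := by
    intro i f g γ hγ a
    let e : Bundle.TotalSpace Γ Z.Fiber := ⟨f, a⟩
    have hp : γ 0 = Bundle.TotalSpace.proj e := γ.source
    let L := cov.liftPath γ e hp
    have hL : ∀ t, (L t).1 = γ t := fun t => congrFun (cov.liftPath_lifts γ e hp) t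
    have hcont : Continuous fun t => (Z.localTriv i (L t)).2 := by
      refine continuous_snd.comp ?_
      refine (Z.localTriv i).continuousOn.comp_continuous L.continuous fun t => ?_
      rw [FiberBundleCore.mem_localTriv_source]
      change (L t).1 ∈ 𝒰.U i
      rw [hL]
      exact hγ t
    have hconst := PreconnectedSpace.constant (Y := Γ) inferInstance hcont (x := 0) (y := 1)
    have happ : ∀ t, (Z.localTriv i (L t)).2 = @HMul.hMul Γ Γ Γ _ (L t).2 (c (𝒰.idx (γ t)) i) := by
      intro t
      rw [FiberBundleCore.localTriv_apply]
      change @HMul.hMul Γ Γ Γ _ (L t).2 (c (𝒰.idx (L t).1) i) = _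
      rw [hL]
    rw [happ, happ] at hconst
    have h0 : L 0 = e := cov.liftPath_zero ..
    have h1 : (L 1).2 = mon (Path.Homotopic.Quotient.mk γ) a := rfl
    rw [h0, h1, γ.source, γ.target] at hconst
    have hg : g ∈ 𝒰.U i := by simpa using hγ 1
    have hm : 𝒰.Meet i (𝒰.idx g) := ⟨g, hg, 𝒰.mem_idx g⟩
    have hm' : 𝒰.Meet (𝒰.idx g) i := ⟨g, 𝒰.mem_idx g, hg⟩
    have hmm : 𝒰.Meet (𝒰.idx g) (𝒰.idx g) := ⟨g, 𝒰.mem_idx g, 𝒰.mem_idx g⟩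
    have h2 := hc _ _ _ hm' hm hmm
    rw [hc.self] at h2
    rw [← mul_assoc]
    change mon (Path.Homotopic.Quotient.mk γ) a = @HMul.hMul Γ Γ Γ _ e.2 (c (𝒰.idx f) i) * c i (𝒰.idx g)
    rw [hconst, mul_assoc, ← h2, mul_one]
  have mon_mul : ∀ {f g : K} (γ : Quotient f g), ∀ a, mon γ a = a * mon γ 1 := by
    intro f g γ
    refine 𝒰.path_induction (P := fun γ => ∀ a, mon γ a = a * mon γ 1) ?_ ?_ γ
    · intro i f g γ hγ a
      rw [mon_small i γ hγ, mon_small i γ hγ, one_mul]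
    · intro f g h γ η h1 h2 a
      rw [mon_trans, mon_trans, h1, h2, mul_assoc, ← h2]
  refine ⟨fun γ => mon γ 1, ?_, ?_⟩
  · intro f g h γ η
    change mon (γ.trans η) 1 = mon γ 1 * mon η 1
    rw [mon_trans, mon_mul]
  · intro i f g γ hγ
    change mon (Path.Homotopic.Quotient.mk γ) 1 = _
    rw [mon_small i γ hγ, one_mul]

/-- On a simply connected space every nerve cocycle is a coboundary. -/
theorem exists_coboundary [SimplyConnectedSpace K] {Γ : Type} [Group Γ] (c : ι → ι → Γ)
    (hc : 𝒰.IsNerveCocycle c) : ∃ g : ι → Γ, ∀ i j, 𝒰.Meet i j → c i j = (g i)⁻¹ * g j := by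
  obtain ⟨hol, htrans, hsmall⟩ := 𝒰.exists_holonomy c hc
  obtain ⟨f₀⟩ : Nonempty K := inferInstance
  choose p hp using fun i => (𝒰.simplyConnected i).nonempty
  let q : ∀ f, Quotient f₀ f := fun f => Path.Homotopic.Quotient.mk (PathConnectedSpace.somePath f₀ f)
  have key : ∀ i f, f ∈ 𝒰.U i → hol (q f) =
      hol (q (p i)) * c (𝒰.idx (p i)) i * c i (𝒰.idx f) := by
    intro i f hf
    obtain ⟨γ, hγ⟩ := 𝒰.exists_path_mem (hp i) hf
    rw [Subsingleton.elim (q f) ((q (p i)).trans (Path.Homotopic.Quotient.mk γ)), htrans, hsmall i γ hγ,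
      mul_assoc]
  refine ⟨fun i => hol (q (p i)) * c (𝒰.idx (p i)) i, ?_⟩
  rintro i j ⟨f, hi, hj⟩
  have h1 := key i f hi
  rw [key j f hj] at h1
  have hm : 𝒰.Meet i (𝒰.idx f) := ⟨f, hi, 𝒰.mem_idx f⟩
  rw [hc i j _ ⟨f, hi, hj⟩ ⟨f, hj, 𝒰.mem_idx f⟩ hm, ← mul_assoc] at h1
  rw [eq_inv_mul_iff_mul_eq]
  exact (mul_right_cancel h1).symm

/-- Every multiplicative function on homotopy classes of paths comes from a nerve cocycle. -/
theorem exists_cocycle_of_multiplicative {Γ : Type} [Group Γ]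
    (u : ∀ {f g : K}, Quotient f g → Γ)
    (hu : ∀ {f g h : K} (γ : Quotient f g) (η : Quotient g h), u (γ.trans η) = u γ * u η) :
    ∃ c : ι → ι → Γ, 𝒰.IsNerveCocycle c ∧ ∃ a : K → Γ,
      ∀ i {f g : K} (γ : Path f g), (∀ t, γ t ∈ 𝒰.U i) →
        u (Path.Homotopic.Quotient.mk γ) = (a f)⁻¹ * (c (𝒰.idx f) i * c i (𝒰.idx g)) * a g := by
  choose p hp using fun i => (𝒰.simplyConnected i).nonempty
  choose τ hτ using fun i (f g : K) (hf : f ∈ 𝒰.U i) (hg : g ∈ 𝒰.U i) => 𝒰.exists_path_mem hf hg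
  let T : ∀ i (f g : K), f ∈ 𝒰.U i → g ∈ 𝒰.U i → Γ := fun i f g hf hg =>
    u (Path.Homotopic.Quotient.mk (τ i f g hf hg))
  have T_eq : ∀ i {f g : K} (hf : f ∈ 𝒰.U i) (hg : g ∈ 𝒰.U i) (γ : Path f g),
      (∀ t, γ t ∈ 𝒰.U i) → u (Path.Homotopic.Quotient.mk γ) = T i f g hf hg := by
    intro i f g hf hg γ hγ
    simp only [T]
    rw [𝒰.homotopic_of_mem γ (τ i f g hf hg) hγ (hτ i f g hf hg)]
  have T_trans : ∀ i (f g h : K) (hf : f ∈ 𝒰.U i) (hg : g ∈ 𝒰.U i) (hh : h ∈ 𝒰.U i),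
      T i f h hf hh = T i f g hf hg * T i g h hg hh := by
    intro i f g h hf hg hh
    rw [← hu, ← Path.Homotopic.Quotient.mk_trans]
    refine (T_eq i hf hh _ fun t => ?_).symm
    have : (τ i f g hf hg).trans (τ i g h hg hh) t ∈
        Set.range ((τ i f g hf hg).trans (τ i g h hg hh)) := ⟨t, rfl⟩
    rw [Path.trans_range] at this
    rcases this with ⟨s, hs⟩ | ⟨s, hs⟩
    · rw [← hs]; exact hτ ..
    · rw [← hs]; exact hτ ..
  have T_self : ∀ i f (hf : f ∈ 𝒰.U i), T i f f hf hf = 1 := fun i f hf => by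
    simpa using T_trans i f f f hf hf hf
  have T_inter : ∀ i j {f g : K} (hf : f ∈ 𝒰.U i) (hg : g ∈ 𝒰.U i) (hf' : f ∈ 𝒰.U j)
      (hg' : g ∈ 𝒰.U j), T i f g hf hg = T j f g hf' hg' := by
    intro i j f g hf hg hf' hg'
    obtain ⟨γ, hγ⟩ := 𝒰.exists_path_mem_inter (i := i) (j := j) ⟨hf, hf'⟩ ⟨hg, hg'⟩
    rw [← T_eq i hf hg γ fun t => (hγ t).1, ← T_eq j hf' hg' γ fun t => (hγ t).2]
  classical
  let c : ι → ι → Γ := fun i j => if h : 𝒰.Meet i j then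
    T i (p i) h.some (hp i) h.some_mem.1 * T j h.some (p j) h.some_mem.2 (hp j) else 1
  have c_eq : ∀ i j f (hi : f ∈ 𝒰.U i) (hj : f ∈ 𝒰.U j),
      c i j = T i (p i) f (hp i) hi * T j f (p j) hj (hp j) := by
    intro i j f hi hj
    have h : 𝒰.Meet i j := ⟨f, hi, hj⟩
    simp only [c, dif_pos h]
    rw [T_trans i (p i) f _ (hp i) hi, T_trans j f h.some _ hj h.some_mem.2 (hp j),
      T_inter i j hi h.some_mem.1 hj h.some_mem.2]
    group
  refine ⟨c, ?_, fun f => T _ (p (𝒰.idx f)) f (hp _) (𝒰.mem_idx f), ?_⟩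
  · intro i j k hij hjk hik
    obtain ⟨f, ⟨hi, hj⟩, hk⟩ := 𝒰.flag i j k hij hjk hik
    rw [c_eq i k f hi hk, c_eq i j f hi hj, c_eq j k f hj hk]
    have : T j f (p j) hj (hp j) * T j (p j) f (hp j) hj = 1 := by rw [← T_trans, T_self]
    rw [mul_assoc, ← mul_assoc (T j f (p j) hj (hp j)), this, one_mul]
  · intro i f g γ hγ
    have hf : f ∈ 𝒰.U i := by simpa using hγ 0
    have hg : g ∈ 𝒰.U i := by simpa using hγ 1
    rw [T_eq i hf hg γ hγ, c_eq _ i f (𝒰.mem_idx f) hf, c_eq i _ g hg (𝒰.mem_idx g)]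
    have : T _ g (p (𝒰.idx g)) (𝒰.mem_idx g) (hp _) * T _ (p (𝒰.idx g)) g (hp _) (𝒰.mem_idx g)
      = 1 := by rw [← T_trans, T_self]
    beta_reduce
    rw [mul_assoc, mul_assoc, mul_assoc, inv_mul_cancel_left, mul_assoc, this, mul_one, ← T_trans]

theorem exists_faithful_multiplicative (f₀ : K) :
    ∃ u : ∀ {f g : K}, Quotient f g → (FundamentalGroup K f₀)ᵐᵒᵖ,
      (∀ {f g h : K} (γ : Quotient f g) (η : Quotient g h), u (γ.trans η) = u γ * u η) ∧
      ∀ γ : Quotient f₀ f₀, u γ = 1 → γ = Quotient.refl f₀ := by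
  classical
  let q : ∀ f, Nonempty (Quotient f₀ f) → Quotient f₀ f := fun f h => h.some
  let u : ∀ {f g : K}, Quotient f g → (FundamentalGroup K f₀)ᵐᵒᵖ := fun {f g} γ =>
    if h : Nonempty (Quotient f₀ f) then
      MulOpposite.op (FundamentalGroup.fromPath
        (((q f h).trans γ).trans (q g ⟨h.some.trans γ⟩).symm))
    else 1
  refine ⟨@u, ?_, ?_⟩
  · intro f g h γ η
    by_cases hf : Nonempty (Quotient f₀ f)
    · have hg : Nonempty (Quotient f₀ g) := ⟨hf.some.trans γ⟩
      simp only [u, dif_pos hf, dif_pos hg]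
      rw [← MulOpposite.op_mul]
      congr 1
      rw [FundamentalGroup.mul_def]
      simp only [FundamentalGroup.fromPath, FundamentalGroup.fromArrow,
        Path.Homotopic.Quotient.trans_assoc]
      congr 2
      rw [← Path.Homotopic.Quotient.trans_assoc (q g _).symm, Path.Homotopic.Quotient.symm_trans,
        Path.Homotopic.Quotient.refl_trans]
    · have hg : ¬ Nonempty (Quotient f₀ g) := fun ⟨r⟩ => hf ⟨r.trans γ.symm⟩
      simp only [u, dif_neg hf, dif_neg hg, mul_one]
  · intro γ hγ
    have h : Nonempty (Quotient f₀ f₀) := ⟨γ⟩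
    simp only [u, dif_pos h] at hγ
    have h2 : ((q f₀ h).trans γ).trans (q f₀ h).symm = Quotient.refl f₀ :=
      MulOpposite.op_injective hγ
    have h3 := congrArg (fun r => ((q f₀ h).symm.trans r).trans (q f₀ h)) h2
    simpa [Path.Homotopic.Quotient.trans_assoc, ← Path.Homotopic.Quotient.trans_assoc (q f₀ h).symm (q f₀ h)] using h3

/-- If all nerve cocycles are coboundaries, fundamental groups are trivial. -/
theorem subsingleton_fundamentalGroup
    (H : ∀ (Γ : Type) [Group Γ] (c : ι → ι → Γ), 𝒰.IsNerveCocycle c →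
      ∃ g : ι → Γ, ∀ i j, 𝒰.Meet i j → c i j = (g i)⁻¹ * g j) (f₀ : K) :
    Subsingleton (FundamentalGroup K f₀) := by
  obtain ⟨u, hu, hinj⟩ := exists_faithful_multiplicative f₀
  obtain ⟨c, hc, a, hca⟩ := 𝒰.exists_cocycle_of_multiplicative u hu
  obtain ⟨b, hb⟩ := H _ c hc
  have key : ∀ {f g : K} (γ : Quotient f g),
      u γ = (b (𝒰.idx f) * a f)⁻¹ * (b (𝒰.idx g) * a g) := by
    intro f g γ
    refine 𝒰.path_induction (P := fun {f g} γ =>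
      u γ = (b (𝒰.idx f) * a f)⁻¹ * (b (𝒰.idx g) * a g)) ?_ ?_ γ
    · intro i f g γ hγ
      have hf : f ∈ 𝒰.U i := by simpa using hγ 0
      have hg : g ∈ 𝒰.U i := by simpa using hγ 1
      rw [hca i γ hγ, hb _ i ⟨f, 𝒰.mem_idx f, hf⟩, hb i _ ⟨g, hg, 𝒰.mem_idx g⟩]
      group
    · intro f g h γ η h1 h2
      rw [hu, h1, h2]
      group
  refine ⟨fun γ η => ?_⟩
  have h1 : ∀ γ : Quotient f₀ f₀, γ = Quotient.refl f₀ := fun γ =>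
    hinj γ (by rw [key γ, inv_mul_cancel])
  exact (h1 γ).trans (h1 η).symm

/-- If nerve cocycles lift, up to coboundary, along surjections, fundamental groups are free. -/
theorem exists_mulEquiv_freeGroup
    (H : ∀ (Γ E : Type) [Group Γ] [Group E] (φ : E →* Γ), Function.Surjective φ →
      ∀ c : ι → ι → Γ, 𝒰.IsNerveCocycle c → ∃ (d : ι → ι → E) (b : ι → Γ), 𝒰.IsNerveCocycle d ∧
        ∀ i j, 𝒰.Meet i j → φ (d i j) = b i * c i j * (b j)⁻¹) (f₀ : K) :
    ∃ S : Type, Nonempty (FundamentalGroup K f₀ ≃* FreeGroup S) := by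
  obtain ⟨u, hu, hinj⟩ := exists_faithful_multiplicative f₀
  obtain ⟨c, hc, a, hca⟩ := 𝒰.exists_cocycle_of_multiplicative u hu
  obtain ⟨d, b, hd, hdc⟩ := H _ _ (FreeGroup.lift (id : (FundamentalGroup K f₀)ᵐᵒᵖ → _))
    (fun x => ⟨FreeGroup.of x, by simp⟩) c hc
  obtain ⟨hol, htrans, hsmall⟩ := 𝒰.exists_holonomy d hd
  have key : ∀ {f g : K} (γ : Quotient f g),
      FreeGroup.lift id (hol γ) = (b (𝒰.idx f) * a f) * u γ * (b (𝒰.idx g) * a g)⁻¹ := by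
    intro f g γ
    refine 𝒰.path_induction (P := fun {f g} γ =>
      FreeGroup.lift id (hol γ) = (b (𝒰.idx f) * a f) * u γ * (b (𝒰.idx g) * a g)⁻¹) ?_ ?_ γ
    · intro i f g γ hγ
      have hf : f ∈ 𝒰.U i := by simpa using hγ 0
      have hg : g ∈ 𝒰.U i := by simpa using hγ 1
      rw [hca i γ hγ, hsmall i γ hγ, map_mul, hdc _ i ⟨f, 𝒰.mem_idx f, hf⟩,
        hdc i _ ⟨g, hg, 𝒰.mem_idx g⟩]
      group
    · intro f g h γ η h1 h2
      rw [hu, htrans, map_mul, h1, h2]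
      group
  let ψ : FundamentalGroup K f₀ →* FreeGroup (FundamentalGroup K f₀)ᵐᵒᵖ :=
    MonoidHom.mk' (fun γ => (hol (γ⁻¹ : FundamentalGroup K f₀))) (by
      intro γ η
      rw [mul_inv_rev, FundamentalGroup.mul_def, htrans])
  have hψ : Function.Injective ψ := by
    rw [injective_iff_map_eq_one]
    intro γ hγ
    have h1 := key (γ⁻¹ : FundamentalGroup K f₀)
    have h2 : hol (γ⁻¹ : FundamentalGroup K f₀) = 1 := hγ
    rw [h2, map_one] at h1
    have h3 : u (γ⁻¹ : FundamentalGroup K f₀) = 1 :=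
      mul_eq_left.1 (mul_inv_eq_one.1 h1.symm)
    have h4 := hinj _ h3
    exact inv_eq_one.1 h4
  have : IsFreeGroup ψ.range := subgroupIsFreeOfIsFree _
  let e := (MonoidHom.ofInjective hψ).trans (IsFreeGroup.toFreeGroup ψ.range)
  exact ⟨_, ⟨e⟩⟩

end GoodCover

end

/-! ### Good covers of geometric realizations -/

section

/-- The barycenter of a finite set. -/
noncomputable def barycenter {X : Type} (s : Finset X) : X → ℝ :=
  Set.indicator (s : Set X) fun _ => (s.card : ℝ)⁻¹

theorem barycenter_nonneg {X : Type} (s : Finset X) (x : X) : 0 ≤ barycenter s x :=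
  Set.indicator_nonneg (fun _ _ => by positivity) x

theorem barycenter_pos {X : Type} {s : Finset X} {x : X} (hx : x ∈ s) : 0 < barycenter s x := by
  rw [barycenter, Set.indicator_of_mem (by simpa using hx)]
  have : 0 < s.card := Finset.card_pos.2 ⟨x, hx⟩
  positivity

theorem sum_barycenter {X : Type} {s t : Finset X} (hs : s.Nonempty) (hst : s ⊆ t) :
    ∑ x ∈ t, barycenter s x = 1 := by
  unfold barycenter
  rw [← Finset.sum_subset hst fun x _ hx => Set.indicator_of_notMem (by simpa using hx) _]
  have : (s.card : ℝ) ≠ 0 := by exact_mod_cast hs.card_pos.ne'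
  rw [Finset.sum_congr rfl fun x hx => Set.indicator_of_mem (by simpa using hx) _]
  simp [this]

variable {X : Type} [PartialOrder X] {S : Set X}

theorem isChain_le_pair {x y : X} (h : x ≤ y ∨ y ≤ x) : IsChain (· ≤ ·) ({x, y} : Set X) := by
  rcases h with h | h
  · exact IsChain.pair h
  · rw [Set.pair_comm]
    exact IsChain.pair h

/-- The open star of a finite set in the geometric realization. -/
def openStar (S : Set X) (s : Finset X) : Set (X → ℝ) :=
  {f | f ∈ geomRealOn S ∧ ∀ x ∈ s, 0 < f x}

theorem barycenter_mem_openStar {s : Finset X} (hs : s.Nonempty) (hS : (s : Set X) ⊆ S)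
    (hc : IsChain (· ≤ ·) (s : Set X)) : barycenter s ∈ openStar S s := by
  have hsupp : Function.support (barycenter s) ⊆ s := Set.support_indicator_subset
  exact ⟨⟨barycenter_nonneg s, hsupp.trans hS, hc.mono hsupp, s, hsupp,
    sum_barycenter hs subset_rfl⟩, fun x hx => barycenter_pos hx⟩

theorem starConvex_openStar {s : Finset X} (hs : s.Nonempty) :
    StarConvex ℝ (barycenter s) (openStar S s) := by
  classical
  rintro f ⟨⟨h0, hS, hc, t, ht, hsum⟩, hpos⟩ a b ha hb hab
  have hst : s ⊆ t := fun x hx => by simpa using ht (hpos x hx).ne'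
  have hsupp : Function.support (a • barycenter s + b • f) ⊆ Function.support f := by
    intro x hx hfx
    apply hx
    have hxs : x ∉ s := fun h => (hpos x h).ne' hfx
    have : barycenter s x = 0 := Set.indicator_of_notMem (by simpa using hxs) _
    simp [hfx, this]
  refine ⟨⟨fun x => ?_, hsupp.trans hS, hc.mono hsupp, t, hsupp.trans ht, ?_⟩, fun x hx => ?_⟩
  · exact add_nonneg (mul_nonneg ha (barycenter_nonneg s x)) (mul_nonneg hb (h0 x))
  · simp only [Pi.add_apply, Pi.smul_apply, smul_eq_mul, Finset.sum_add_distrib,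
      ← Finset.mul_sum, sum_barycenter hs hst, hsum, mul_one, hab]
  · change 0 < a * barycenter s x + b * f x
    have h1 := barycenter_pos hx
    have h2 := hpos x hx
    rcases ha.eq_or_lt with rfl | ha
    · obtain rfl : b = 1 := by simpa using hab
      simpa using h2
    · have := mul_nonneg hb h2.le
      positivity

theorem isSimplyConnected_openStar {s : Finset X} (hs : s.Nonempty) (hS : (s : Set X) ⊆ S)
    (hc : IsChain (· ≤ ·) (s : Set X)) : IsSimplyConnected (openStar S s) := by
  have := (starConvex_openStar (S := S) hs).contractibleSpace
    ⟨_, barycenter_mem_openStar hs hS hc⟩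
  exact SimplyConnectedSpace.ofContractible _

/-- The cover of a geometric realization by the open stars of the vertices. -/
noncomputable def starCover (S : Set X) : GoodCover ↥(geomRealOn S) ↥S where
  U v := {f | 0 < f.1 v.1}
  isOpen v := isOpen_lt continuous_const
    ((continuous_apply v.1).comp continuous_subtype_val)
  simplyConnected v := by
    rw [← Topology.IsEmbedding.subtypeVal.isSimplyConnected_image]
    convert isSimplyConnected_openStar (S := S) (s := {v.1}) (by simp) (by simp) (by simp)
    ext f
    simp [openStar, and_comm]
  pathConnected v w h := by
    classical
    obtain ⟨f, hv, hw⟩ := h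
    have hvw := f.2.2.2.1.total (ne_of_gt hv) (ne_of_gt hw)
    rw [Topology.IsInducing.subtypeVal.isPathConnected_iff]
    convert (isSimplyConnected_openStar (S := S) (s := {v.1, w.1}) (by simp) (by
      rintro x hx
      simp only [Finset.coe_insert, Finset.coe_singleton, Set.mem_insert_iff,
        Set.mem_singleton_iff] at hx
      rcases hx with rfl | rfl
      exacts [v.2, w.2]) (by
      simp only [Finset.coe_insert, Finset.coe_singleton]
      exact isChain_le_pair hvw)).isPathConnected
    ext f
    simp only [openStar, Set.mem_image, Set.mem_inter_iff, Set.mem_ofPred_eq, Subtype.exists,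
      exists_and_right, exists_eq_right, Finset.mem_insert, Finset.mem_singleton,
      forall_eq_or_imp, forall_eq]
    tauto
  flag u v w huv hvw huw := by
    classical
    obtain ⟨f, hu, hv⟩ := huv
    obtain ⟨f', hv', hw⟩ := hvw
    obtain ⟨f'', hu', hw'⟩ := huw
    have h1 := f.2.2.2.1.total (ne_of_gt hu) (ne_of_gt hv)
    have h2 := f'.2.2.2.1.total (ne_of_gt hv') (ne_of_gt hw)
    have h3 := f''.2.2.2.1.total (ne_of_gt hu') (ne_of_gt hw')
    obtain ⟨hb, hpos⟩ := barycenter_mem_openStar (S := S) (s := {u.1, v.1, w.1}) (by simp) (by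
      rintro x hx
      simp only [Finset.coe_insert, Finset.coe_singleton, Set.mem_insert_iff,
        Set.mem_singleton_iff] at hx
      rcases hx with rfl | rfl | rfl
      exacts [u.2, v.2, w.2]) (by
      simp only [Finset.coe_insert, Finset.coe_singleton]
      refine (isChain_le_pair h2).insert ?_
      rintro b (rfl | rfl) -
      exacts [h1, h3])
    exact ⟨⟨_, hb⟩, ⟨hpos u (by simp), hpos v (by simp)⟩, hpos w (by simp)⟩
  idx f :=
    have h : ∃ x, f.1 x ≠ 0 := by
      obtain ⟨s, -, hs⟩ := f.2.2.2.2
      by_contra! h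
      simp [h] at hs
    ⟨h.choose, f.2.2.1 h.choose_spec⟩
  mem_idx f := by
    have h : ∃ x, f.1 x ≠ 0 := by
      obtain ⟨s, -, hs⟩ := f.2.2.2.2
      by_contra! h
      simp [h] at hs
    exact lt_of_le_of_ne (f.2.1 _) h.choose_spec.symm

theorem starCover_meet_iff {v w : ↥S} :
    (starCover S).Meet v w ↔ (v.1 ≤ w.1 ∨ w.1 ≤ v.1) := by
  classical
  constructor
  · rintro ⟨f, hv, hw⟩
    exact f.2.2.2.1.total (ne_of_gt hv) (ne_of_gt hw)
  · intro hvw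
    obtain ⟨hb, hpos⟩ := barycenter_mem_openStar (S := S) (s := {v.1, w.1}) (by simp) (by
      rintro x hx
      simp only [Finset.coe_insert, Finset.coe_singleton, Set.mem_insert_iff,
        Set.mem_singleton_iff] at hx
      rcases hx with rfl | rfl
      exacts [v.2, w.2]) (by
      simp only [Finset.coe_insert, Finset.coe_singleton]
      exact isChain_le_pair hvw)
    exact ⟨⟨_, hb⟩, hpos v (by simp), hpos w (by simp)⟩

/-! ### Nonabelian first cohomology of posets -/

/-- A 1-cocycle on a subset of a poset. -/
def IsPosetCocycle {Γ : Type} [Group Γ] (S : Set X) (c : X → X → Γ) : Prop :=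
  ∀ x ∈ S, ∀ y ∈ S, ∀ z ∈ S, x ≤ y → y ≤ z → c x z = c x y * c y z

/-- A 1-cocycle on a subset of a poset is a coboundary. -/
def IsPosetCoboundary {Γ : Type} [Group Γ] (S : Set X) (c : X → X → Γ) : Prop :=
  ∃ g : X → Γ, ∀ x ∈ S, ∀ y ∈ S, x ≤ y → c x y = (g x)⁻¹ * g y

/-- Every 1-cocycle with nonabelian coefficients on `S` is a coboundary. -/
def TrivialH1 (S : Set X) : Prop :=
  ∀ (Γ : Type) [Group Γ] (c : X → X → Γ), IsPosetCocycle S c → IsPosetCoboundary S c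

theorem IsPosetCocycle.self {Γ : Type} [Group Γ] {c : X → X → Γ} (hc : IsPosetCocycle S c)
    {x : X} (hx : x ∈ S) : c x x = 1 := by
  simpa using hc x hx x hx x hx le_rfl le_rfl

theorem IsPosetCocycle.mono {Γ : Type} [Group Γ] {c : X → X → Γ} (hc : IsPosetCocycle S c)
    {T : Set X} (h : T ⊆ S) : IsPosetCocycle T c :=
  fun x hx y hy z hz => hc x (h hx) y (h hy) z (h hz)

open scoped Classical in
theorem exists_nerveCocycle {Γ : Type} [Group Γ] {c : X → X → Γ} (hc : IsPosetCocycle S c) :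
    ∃ d : ↥S → ↥S → Γ, (starCover S).IsNerveCocycle d ∧
      ∀ x y : ↥S, x.1 ≤ y.1 → d x y = c x y := by
  refine ⟨fun x y => if x.1 ≤ y.1 then c x y else (c y x)⁻¹, ?_, fun x y h => if_pos h⟩
  have hd : ∀ x y : ↥S, (x.1 ≤ y.1 ∨ y.1 ≤ x.1) →
      (y.1 ≤ x.1 → (if x.1 ≤ y.1 then c x y else (c y x)⁻¹) = (c y x)⁻¹) := by
    intro x y _ h
    split_ifs with h'
    · obtain rfl : x = y := Subtype.ext (le_antisymm h' h)
      simp [hc.self x.2]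
    · rfl
  intro x y z hxy hyz hxz
  rw [starCover_meet_iff] at hxy hyz hxz
  have key := fun (x y z : ↥S) => hc x x.2 y y.2 z z.2
  beta_reduce
  rcases hxy with h1 | h1 <;> rcases hyz with h2 | h2 <;> rcases hxz with h3 | h3
  · rw [if_pos h1, if_pos h2, if_pos h3, key x y z h1 h2]
  · rw [if_pos h1, if_pos h2, hd x z (.inr h3) h3, eq_comm, ← inv_eq_iff_eq_inv, eq_comm]
    have := key z x y h3 h1
    have e : y = z := Subtype.ext (le_antisymm h2 (h3.trans h1))
    subst e
    rw [hc.self y.2] at this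
    rw [hc.self y.2, mul_one, eq_inv_iff_mul_eq_one, this]
  · rw [if_pos h1, hd y z (.inr h2) h2, if_pos h3, key x z y h3 h2]
    group
  · rw [if_pos h1, hd y z (.inr h2) h2, hd x z (.inr h3) h3, key z x y h3 h1]
    group
  · rw [hd x y (.inr h1) h1, if_pos h2, if_pos h3, key y x z h1 h3]
    group
  · rw [hd x y (.inr h1) h1, if_pos h2, hd x z (.inr h3) h3, key y z x h2 h3]
    group
  · have e : x = y := Subtype.ext (le_antisymm (h3.trans h2) h1)
    subst e
    rw [hd x z (.inr h2) h2, hd x x (.inr h1) h1, hc.self x.2]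
    group
  · rw [hd x y (.inr h1) h1, hd y z (.inr h2) h2, hd x z (.inr h3) h3, key z y x h2 h1]
    group

theorem TrivialH1.of_simplyConnectedSpace [SimplyConnectedSpace ↥(geomRealOn S)] :
    TrivialH1 S := by
  classical
  intro Γ _ c hc
  obtain ⟨d, hd, hdc⟩ := exists_nerveCocycle hc
  obtain ⟨g, hg⟩ := (starCover S).exists_coboundary d hd
  refine ⟨fun x => if h : x ∈ S then g ⟨x, h⟩ else 1, fun x hx y hy hxy => ?_⟩
  beta_reduce
  rw [dif_pos hx, dif_pos hy, ← hg ⟨x, hx⟩ ⟨y, hy⟩ (starCover_meet_iff.2 (.inl hxy)),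
    hdc ⟨x, hx⟩ ⟨y, hy⟩ hxy]

theorem TrivialH1.subsingleton_fundamentalGroup (h : TrivialH1 S) (f : ↥(geomRealOn S)) :
    Subsingleton (FundamentalGroup ↥(geomRealOn S) f) := by
  classical
  refine (starCover S).subsingleton_fundamentalGroup (fun Γ _ c hc => ?_) f
  obtain ⟨g, hg⟩ := h Γ (fun x y => if h : x ∈ S ∧ y ∈ S then c ⟨x, h.1⟩ ⟨y, h.2⟩ else 1) (by
    intro x hx y hy z hz hxy hyz
    simp only [hx, hy, hz, and_self, dite_true]
    exact hc _ _ _ (starCover_meet_iff.2 (.inl hxy)) (starCover_meet_iff.2 (.inl hyz))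
      (starCover_meet_iff.2 (.inl (hxy.trans hyz))))
  have key : ∀ i j : ↥S, i.1 ≤ j.1 → c i j = (g i)⁻¹ * g j := fun i j hij => by
    simpa using hg i i.2 j j.2 hij
  refine ⟨fun i => g i, fun i j hij => ?_⟩
  have hij' := starCover_meet_iff.1 hij
  rcases hij' with h | h
  · exact key i j h
  · have hii : (starCover S).Meet i i := starCover_meet_iff.2 (.inl le_rfl)
    have := hc i j i hij (starCover_meet_iff.2 (.inl h)) hii
    rw [hc.self, key j i h] at this
    rw [eq_comm, mul_eq_one_iff_eq_inv] at this
    rw [this]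
    group

/-- Triviality of `H¹` passes to retracts. -/
theorem TrivialH1.of_retract {Y : Type} [PartialOrder Y] {T : Set Y} (h : TrivialH1 T)
    (f : X → Y) (f' : Y → X) (hf : ∀ x ∈ S, f x ∈ T) (hf' : ∀ y ∈ T, f' y ∈ S)
    (hfm : ∀ x ∈ S, ∀ y ∈ S, x ≤ y → f x ≤ f y) (hfm' : ∀ x ∈ T, ∀ y ∈ T, x ≤ y → f' x ≤ f' y)
    (hff : ∀ x ∈ S, f' (f x) = x) : TrivialH1 S := by
  intro Γ _ c hc
  obtain ⟨g, hg⟩ := h Γ (fun x y => c (f' x) (f' y)) (fun x hx y hy z hz hxy hyz =>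
    hc _ (hf' x hx) _ (hf' y hy) _ (hf' z hz) (hfm' x hx y hy hxy) (hfm' y hy z hz hyz))
  refine ⟨fun x => g (f x), fun x hx y hy hxy => ?_⟩
  have := hg _ (hf x hx) _ (hf y hy) (hfm x hx y hy hxy)
  beta_reduce at this
  rwa [hff x hx, hff y hy] at this

end

/-! ### Lifting cocycles -/

namespace GoodCover

variable {K : Type} [TopologicalSpace K] {ι : Type} {𝒰 : GoodCover K ι}

theorem Meet.symm {i j : ι} (h : 𝒰.Meet i j) : 𝒰.Meet j i := by
  rwa [Meet, Set.inter_comm]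

theorem Meet.left {i j : ι} (h : 𝒰.Meet i j) : 𝒰.Meet i i := by
  obtain ⟨f, hi, -⟩ := h
  exact ⟨f, hi, hi⟩

theorem IsNerveCocycle.inv {Γ : Type} [Group Γ] {c : ι → ι → Γ} (hc : 𝒰.IsNerveCocycle c)
    {i j : ι} (h : 𝒰.Meet i j) : (c i j)⁻¹ = c j i := by
  have := hc i j i h h.symm h.left
  rw [hc.self, eq_comm] at this
  exact inv_eq_of_mul_eq_one_right this

/-- The fundamental group is free if the nerve is the join of a nonempty discrete set `D` with
its complement. -/
theorem exists_mulEquiv_freeGroup_of_discrete (D : Set ι) {d₀ : ι} (hd₀ : d₀ ∈ D)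
    (hD : ∀ d ∈ D, ∀ d' ∈ D, 𝒰.Meet d d' → d = d') (hcomp : ∀ d ∈ D, ∀ x ∉ D, 𝒰.Meet d x)
    (f₀ : K) : ∃ S : Type, Nonempty (FundamentalGroup K f₀ ≃* FreeGroup S) := by
  classical
  refine 𝒰.exists_mulEquiv_freeGroup (fun Γ E _ _ φ hφ c hc => ?_) f₀
  obtain ⟨s, hs⟩ := hφ.hasRightInverse
  let b : ι → Γ := fun i => if i ∈ D then 1 else c d₀ i
  have b_mem : ∀ {i}, i ∈ D → b i = 1 := fun h => if_pos h
  have b_notMem : ∀ {i}, i ∉ D → b i = c d₀ i := fun h => if_neg h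
  have b_const : ∀ {d i j}, d ∈ D → i ∉ D → j ∉ D → 𝒰.Meet i j →
      c d i * (b i)⁻¹ = c d j * (b j)⁻¹ := by
    intro d i j hd hi hj hij
    rw [b_notMem hi, b_notMem hj, hc d i j (hcomp d hd i hi) hij (hcomp d hd j hj),
      hc d₀ i j (hcomp _ hd₀ i hi) hij (hcomp _ hd₀ j hj)]
    group
  refine ⟨fun i j => if i ∈ D then (if j ∈ D then 1 else s (c i j * (b j)⁻¹)) else
    (if j ∈ D then (s (c j i * (b i)⁻¹))⁻¹ else 1), b, ?_, ?_⟩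
  · intro i j k hij hjk hik
    beta_reduce
    by_cases hi : i ∈ D <;> by_cases hj : j ∈ D <;> by_cases hk : k ∈ D <;>
      simp only [hi, hj, hk, if_true, if_false, mul_one, one_mul]
    · rw [hD i hi j hj hij]
    · rw [hD i hi k hk hik, mul_inv_cancel]
    · rw [b_const hi hj hk hjk]
    · rw [hD j hj k hk hjk]
    · rw [b_const hj hi hk hik, inv_mul_cancel]
    · rw [b_const hk hi hj hij]
  · intro i j hij
    beta_reduce
    by_cases hi : i ∈ D <;> by_cases hj : j ∈ D <;>
      simp only [hi, hj, if_true, if_false, map_one, map_inv]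
    · obtain rfl := hD i hi j hj hij
      simp [hc.self]
    · rw [hs, b_mem hi, one_mul]
    · rw [hs, b_mem hj, ← hc.inv hij]
      group
    · rw [b_notMem hi, b_notMem hj, hc d₀ i j (hcomp _ hd₀ i hi) hij (hcomp _ hd₀ j hj)]
      group

/-- The fundamental group is free if the nerve is a graph. -/
theorem exists_mulEquiv_freeGroup_of_graph
    (h : ∀ i j k, 𝒰.Meet i j → 𝒰.Meet j k → 𝒰.Meet i k → i = j ∨ j = k ∨ i = k) (f₀ : K) :
    ∃ S : Type, Nonempty (FundamentalGroup K f₀ ≃* FreeGroup S) := by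
  classical
  refine 𝒰.exists_mulEquiv_freeGroup (fun Γ E _ _ φ hφ c hc => ?_) f₀
  obtain ⟨s, hs⟩ := hφ.hasRightInverse
  let e : ι → ι → E := fun i j => if i = j then 1 else
    if WellOrderingRel i j then s (c i j) else (s (c j i))⁻¹
  have e_self : ∀ i, e i i = 1 := fun i => if_pos rfl
  have e_mul : ∀ i j, e i j * e j i = 1 := by
    intro i j
    by_cases hij : i = j
    · rw [hij, e_self, one_mul]
    · simp only [e, hij, Ne.symm hij, if_false]
      rcases trichotomous_of (WellOrderingRel (α := ι)) i j with h | h | h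
      · have h' : ¬ WellOrderingRel j i := fun h' => asymm_of _ h h'
        rw [if_pos h, if_neg h', mul_inv_cancel]
      · exact absurd h hij
      · have h' : ¬ WellOrderingRel i j := fun h' => asymm_of _ h h'
        rw [if_pos h, if_neg h', inv_mul_cancel]
  refine ⟨e, 1, ?_, ?_⟩
  · intro i j k hij hjk hik
    rcases h i j k hij hjk hik with rfl | rfl | rfl
    · rw [e_self, one_mul]
    · rw [e_self, mul_one]
    · rw [e_self, e_mul]
  · intro i j hij
    by_cases h : i = j
    · subst h
      simp [e, hc.self]
    · simp only [e, h, if_false, Pi.one_apply, one_mul, inv_one, mul_one]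
      split_ifs
      · exact hs _
      · rw [map_inv, hs, hc.inv hij.symm]

end GoodCover

/-! ### Connected posets and a fibre lemma -/

section

variable {X Y : Type} [PartialOrder X] [PartialOrder Y]

/-- A subset of a poset is connected if it is nonempty and every predicate which is invariant
along the order relation is constant. -/
def IsPosetConnected (S : Set X) : Prop :=
  S.Nonempty ∧ ∀ φ : X → Prop, (∀ x ∈ S, ∀ y ∈ S, x ≤ y → (φ x ↔ φ y)) →
    ∀ x ∈ S, ∀ y ∈ S, φ x → φ y

theorem IsPosetConnected.eq_of_forall_le {S : Set X} (h : IsPosetConnected S) {α : Type}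
    (ψ : X → α) (hψ : ∀ x ∈ S, ∀ y ∈ S, x ≤ y → ψ x = ψ y) {x y : X} (hx : x ∈ S) (hy : y ∈ S) :
    ψ x = ψ y :=
  h.2 (fun z => ψ x = ψ z) (fun a ha b hb hab => by rw [hψ a ha b hb hab]) x hx y hy rfl

theorem isPosetConnected_of_isLeast {S : Set X} {b : X} (h : IsLeast S b) : IsPosetConnected S :=
  ⟨⟨b, h.1⟩, fun _ hφ x hx y hy hx' =>
    (hφ b h.1 y hy (h.2 hy)).1 ((hφ b h.1 x hx (h.2 hx)).2 hx')⟩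

theorem TrivialH1.of_isConicallyContractible {S : Set X} (j : X → X) (b : X) (hb : b ∈ S)
    (hj : ∀ x ∈ S, j x ∈ S) (hxj : ∀ x ∈ S, x ≤ j x) (hbj : ∀ x ∈ S, b ≤ j x)
    (hmono : ∀ x ∈ S, ∀ y ∈ S, x ≤ y → j x ≤ j y) : TrivialH1 S := by
  intro Γ _ c hc
  refine ⟨fun x => c b (j x) * (c x (j x))⁻¹, fun x hx y hy hxy => ?_⟩
  have h1 := hc b hb _ (hj x hx) _ (hj y hy) (hbj x hx) (hmono x hx y hy hxy)
  have h2 := hc x hx _ (hj x hx) _ (hj y hy) (hxj x hx) (hmono x hx y hy hxy)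
  have h3 := hc x hx _ hy _ (hj y hy) hxy (hxj y hy)
  rw [h2] at h3
  beta_reduce
  rw [h1, eq_mul_inv_of_mul_eq h3.symm]
  group

/-- A fibre lemma: if the fibres of `f : S → T` over a suitable cofinal part `W` of `T` are
connected with trivial `H¹`, and `T` has trivial `H¹`, then so has `S`. -/
theorem TrivialH1.of_fibres [Nonempty X] {S : Set X} {T W : Set Y} (f : X → Y) (hT : TrivialH1 T)
    (hf : ∀ x ∈ S, f x ∈ T) (hmono : ∀ x ∈ S, ∀ y ∈ S, x ≤ y → f x ≤ f y)
    (hW : ∀ y ∈ T, IsPosetConnected {w | w ∈ W ∧ y ≤ w})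
    (hne : ∀ y ∈ T, {x | x ∈ S ∧ f x ≤ y}.Nonempty)
    (hconn : ∀ y ∈ W, IsPosetConnected {x | x ∈ S ∧ f x ≤ y})
    (htriv : ∀ y ∈ W, ∃ y', y ≤ y' ∧ TrivialH1 {x | x ∈ S ∧ f x ≤ y'}) : TrivialH1 S := by
  intro Γ _ c hc
  have hcob : ∀ y ∈ W, IsPosetCoboundary {x | x ∈ S ∧ f x ≤ y} c := by
    intro y hy
    obtain ⟨y', hyy', h⟩ := htriv y hy
    obtain ⟨g, hg⟩ := h Γ c (hc.mono fun x hx => hx.1)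
    exact ⟨g, fun x hx z hz => hg x ⟨hx.1, hx.2.trans hyy'⟩ z ⟨hz.1, hz.2.trans hyy'⟩⟩
  choose! γ hγ using hcob
  have transport : ∀ w ∈ W, ∀ w' ∈ W, w ≤ w' → ∀ x ∈ S, ∀ x' ∈ S, f x ≤ w → f x' ≤ w →
      (γ w x)⁻¹ * γ w x' = (γ w' x)⁻¹ * γ w' x' := by
    intro w hw w' hw' hww' x hx x' hx' hxw hxw'
    have := (hconn w hw).eq_of_forall_le (fun z => γ w' z * (γ w z)⁻¹) (by
      intro a ha b hb hab
      have h1 := hγ w hw a ha b hb hab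
      rw [hγ w' hw' a ⟨ha.1, ha.2.trans hww'⟩ b ⟨hb.1, hb.2.trans hww'⟩ hab,
        inv_mul_eq_iff_eq_mul] at h1
      rw [h1]
      group) (x := x) (y := x') ⟨hx, hxw⟩ ⟨hx', hxw'⟩
    rw [mul_inv_eq_iff_eq_mul] at this
    rw [this]
    group
  choose! m hm using fun y hy => (hW y hy).1
  let Q : Y → X → X → Γ := fun y x x' => (γ (m y) x)⁻¹ * γ (m y) x'
  have Q_trans : ∀ y x x' x'', Q y x x' * Q y x' x'' = Q y x x'' := by
    intro y x x' x''
    simp only [Q]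
    group
  have Q_eq : ∀ y ∈ T, ∀ w ∈ W, y ≤ w → ∀ x ∈ S, ∀ x' ∈ S, f x ≤ y → f x' ≤ y →
      Q y x x' = (γ w x)⁻¹ * γ w x' := by
    intro y hy w hw hyw x hx x' hx' hxy hxy'
    exact (hW y hy).eq_of_forall_le (fun z => (γ z x)⁻¹ * γ z x') (fun a ha b hb hab =>
      transport a ha.1 b hb.1 hab x hx x' hx' (hxy.trans ha.2) (hxy'.trans ha.2)) (hm y hy)
      ⟨hw, hyw⟩
  have Q_le : ∀ y ∈ T, ∀ y' ∈ T, y ≤ y' → ∀ x ∈ S, ∀ x' ∈ S, f x ≤ y → f x' ≤ y →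
      Q y x x' = Q y' x x' := by
    intro y hy y' hy' hyy' x hx x' hx' hxy hxy'
    exact Q_eq y hy _ (hm y' hy').1 (hyy'.trans (hm y' hy').2) x hx x' hx' hxy hxy'
  choose! p hp using hne
  obtain ⟨h, hh⟩ := hT Γ (fun y y' => Q y' (p y) (p y')) (by
    intro y hy y' hy' y'' hy'' h1 h2
    beta_reduce
    rw [Q_le y' hy' y'' hy'' h2 _ (hp y hy).1 _ (hp y' hy').1 ((hp y hy).2.trans h1)
      (hp y' hy').2, Q_trans])
  refine ⟨fun x => h (f x) * Q (f x) (p (f x)) x, fun x hx x' hx' hxx' => ?_⟩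
  have hle := hmono x hx x' hx' hxx'
  have hd := hh _ (hf x hx) _ (hf x' hx') hle
  have hpx := hp _ (hf x hx)
  beta_reduce at hd ⊢
  rw [Q_le _ (hf x hx) _ (hf x' hx') hle _ hpx.1 x hx hpx.2 le_rfl, mul_inv_rev, mul_assoc,
    ← mul_assoc _ (h (f x')), ← hd, Q_trans, inv_mul_eq_of_eq_mul (Q_trans ..).symm]
  have hmx := hm _ (hf x' hx')
  exact hγ _ hmx.1 x ⟨hx, hle.trans hmx.2⟩ x' ⟨hx', hmx.2⟩ hxx'

end

/-! ### Coprime action -/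

section

theorem addSubgroup_eq_top_of_fixedPoints {B W : Type*} [Group B] [AddCommGroup W] [Finite W]
    {p : ℕ} (hp : p.Prime) (hW : ¬ p ∣ Nat.card W) (ρ : B →* AddMonoid.End W)
    (hB : IsElementaryAbelian p B) {Z : Subgroup B}
    (hZ : ∀ x, Z ⊔ Subgroup.zpowers x ≠ ⊤) (T : AddSubgroup W)
    (hT : ∀ a ∉ Z, ∀ v, ρ a v = v → v ∈ T) : T = ⊤ := by
  obtain ⟨x, hx⟩ : ∃ x, x ∉ Z := by
    by_contra! h
    exact hZ 1 (by simp [eq_top_iff, SetLike.le_def, h])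
  obtain ⟨y, hy⟩ : ∃ y, y ∉ Z ⊔ Subgroup.zpowers x := by
    by_contra! h
    exact hZ x (by simp [eq_top_iff, SetLike.le_def, h])
  have hxy : ∀ i : ℕ, x ^ i * y ∉ Z := fun i h => hy <| by
    have h1 := Subgroup.mul_mem _ (Subgroup.inv_mem _ (Subgroup.mem_sup_right (S := Z)
      (Subgroup.pow_mem _ (Subgroup.mem_zpowers x) i)))
      (Subgroup.mem_sup_left (T := Subgroup.zpowers x) h)
    rwa [inv_mul_cancel_left] at h1
  let tr : B → AddMonoid.End W := fun a => ∑ j ∈ Finset.range p, ρ (a ^ j)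
  have tr_apply : ∀ a v, tr a v = ∑ j ∈ Finset.range p, ρ (a ^ j) v := fun a v =>
    AddMonoidHom.finsetSum_apply _ _ v
  have tr_mem : ∀ a ∉ Z, ∀ v, tr a v ∈ T := by
    intro a ha v
    refine hT a ha _ ?_
    have : ρ a * tr a = tr a := by
      simp only [tr, Finset.mul_sum, ← map_mul, ← pow_succ']
      have h := Finset.sum_range_succ (fun j => ρ (a ^ j)) p
      rw [Finset.sum_range_succ'] at h
      simpa [hB.2 a] using h
    exact DFunLike.congr_fun this v
  have key : ∀ v : W, p • v ∈ T := by
    intro v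
    have h1 : ∑ i ∈ Finset.range p, tr (x ^ i * y) v ∈ T :=
      T.sum_mem fun i _ => tr_mem _ (hxy i) v
    have h2 : ∑ i ∈ Finset.range p, tr (x ^ i * y) v =
        ∑ j ∈ Finset.range p, ∑ i ∈ Finset.range p, ρ ((x ^ j) ^ i) (ρ (y ^ j) v) := by
      simp only [tr_apply]
      rw [Finset.sum_comm]
      refine Finset.sum_congr rfl fun j _ => Finset.sum_congr rfl fun i _ => ?_
      rw [(show Commute (x ^ i) y from hB.1 _ _).mul_pow, ← pow_mul, ← pow_mul, mul_comm j i,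
        map_mul]
      rfl
    rw [h2, ← Nat.succ_pred_eq_of_pos hp.pos, Finset.sum_range_succ',
      Nat.succ_pred_eq_of_pos hp.pos] at h1
    have h3 : ∑ j ∈ Finset.range p.pred, ∑ i ∈ Finset.range p,
        ρ ((x ^ (j + 1)) ^ i) (ρ (y ^ (j + 1)) v) ∈ T := by
      refine T.sum_mem fun j hj => ?_
      rw [Finset.mem_range] at hj
      have hj' : j + 1 < p := by
        have := Nat.succ_pred_eq_of_pos hp.pos
        omega
      have hxj : x ^ (j + 1) ∉ Z := by
        intro h
        obtain ⟨m, hm⟩ := exists_pow_eq_self_of_coprime (n := j + 1) (x := x) <|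
          Nat.Coprime.coprime_dvd_right (orderOf_dvd_of_pow_eq_one (hB.2 x))
            
            (Nat.coprime_of_lt_prime (Nat.succ_ne_zero j) hj' hp).symm
        exact hx (hm ▸ Z.pow_mem h m)
      rw [← tr_apply]
      exact tr_mem _ hxj _
    have h4 := (T.add_mem_cancel_left h3).1 h1
    simpa using h4
  rw [eq_top_iff]
  intro v _
  have hcop : Nat.Coprime p (Nat.card W) := (hp.coprime_iff_not_dvd).2 hW
  have hv : (Nat.card W) • v ∈ T := by rw [card_nsmul_eq_zero']; exact T.zero_mem
  have hg := Nat.gcd_eq_gcd_ab p (Nat.card W)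
  rw [hcop] at hg
  have : v = (Nat.gcdA p (Nat.card W)) • (p • v) + Nat.gcdB p (Nat.card W) • (Nat.card W • v) := by
    rw [← natCast_zsmul, ← natCast_zsmul, ← mul_zsmul, ← mul_zsmul, ← add_zsmul, mul_comm _ (p : ℤ),
      mul_comm _ (Nat.card W : ℤ), ← hg]
    simp
  rw [this]
  exact T.add_mem (T.zsmul_mem (key v) _) (T.zsmul_mem hv _)

theorem IsElementaryAbelian.isPGroup {p : ℕ} {B : Type*} [Group B]
    (hB : IsElementaryAbelian p B) : IsPGroup p B :=
  fun a => ⟨1, by rw [pow_one, hB.2]⟩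

section

variable {G : Type*} [Group G] {B K : Subgroup G}

/-- The conjugation action of a subgroup on a subgroup which it normalizes. -/
noncomputable def conjAction (h : B ≤ Subgroup.normalizer (K : Set G)) : ↥B →* MulAut ↥K :=
  (Subgroup.normalizerMonoidHom K).comp (Subgroup.inclusion h)

theorem coe_conjAction (h : B ≤ Subgroup.normalizer (K : Set G)) (b : ↥B) (k : ↥K) :
    (conjAction h b k : G) = b * k * (b : G)⁻¹ := rfl

/-- A `p`-group acting on a `p'`-group normalizes some Sylow `q`-subgroup. -/
theorem exists_sylow_le_normalizer [Finite G] {p q : ℕ} (hp : p.Prime) [Fact q.Prime]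
    (hB : IsPGroup p ↥B) (hK : ¬ p ∣ Nat.card ↥K) (h : B ≤ Subgroup.normalizer (K : Set G)) :
    ∃ P : Sylow q ↥K,
      B ≤ Subgroup.normalizer ((P : Subgroup ↥K).map K.subtype : Set G) := by
  have := Fact.mk hp
  let : MulDistribMulAction ↥B ↥K := MulDistribMulAction.compHom _ (conjAction h)
  obtain ⟨P⟩ : Nonempty (Sylow q ↥K) := inferInstance
  obtain ⟨Q, hQ⟩ := hB.nonempty_fixed_point_of_prime_not_dvd_card (Sylow q ↥K) fun hd =>
    hK (hd.trans (P.card_dvd_index.trans (Subgroup.index_dvd_card _)))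
  refine ⟨Q, Subgroup.le_normalizer_iff.2 ?_⟩
  rintro b hb _ ⟨k, hk, rfl⟩
  have h1 := hQ ⟨b, hb⟩
  have h2 := Subgroup.smul_mem_pointwise_smul k (⟨b, hb⟩ : ↥B) (Q : Subgroup ↥K) hk
  rw [← Sylow.pointwise_smul_def, h1] at h2
  exact ⟨_, h2, rfl⟩

/-- An element of order `p` acting on a `p'`-group fixes a point in each invariant coset of
the commutator subgroup. -/
theorem exists_fixed_of_abelianization {K : Type*} [Group K] [Finite K] {p : ℕ} (hp : p.Prime)
    (hK : ¬ p ∣ Nat.card K) (σ : MulAut K) (hσ : σ ^ p = 1) (k : K)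
    (hk : Abelianization.of (σ k) = Abelianization.of k) :
    ∃ k', Abelianization.of k' = Abelianization.of k ∧ σ k' = k' := by
  classical
  have := Fact.mk hp
  have := Fintype.ofFinite K
  let X := {k' : K // Abelianization.of k' = Abelianization.of k}
  have hX : ¬ p ∣ Fintype.card X := by
    rw [← Nat.card_eq_fintype_card]
    have e : Nat.card X = Nat.card (Abelianization.of (G := K)).ker :=
      Nat.card_congr ((Abelianization.of (G := K)).fiberEquivKer k)
    rw [e]
    exact fun hd => hK (hd.trans (Subgroup.card_subgroup_dvd_card _))
  have hmap : ∀ k' : K, Abelianization.of k' = Abelianization.of k ↔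
      Abelianization.of (σ k') = Abelianization.of k := by
    intro k'
    have hinj : Function.Injective σ.abelianizationCongr := σ.abelianizationCongr.injective
    rw [← hk, ← hinj.eq_iff]
    simp [abelianizationCongr_of, hk]
  let τ : Equiv.Perm X := σ.toEquiv.subtypeEquiv hmap
  have hτ : ∀ n (x : X), (((τ ^ n) x : X) : K) = (σ ^ n) x := by
    intro n x
    induction n with
    | zero => rfl
    | succ n ih =>
      rw [pow_succ', pow_succ']
      change σ ((τ ^ n) x : X) = σ ((σ ^ n) x)
      rw [ih]
  obtain ⟨x, hx⟩ := Equiv.Perm.exists_fixed_point_of_prime (p := p) (n := 1) hX (σ := τ) (by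
    ext x
    rw [pow_one, hτ, hσ]
    rfl)
  exact ⟨x, x.2, congrArg Subtype.val hx⟩

/-- The action of automorphisms on the abelianization, as additive endomorphisms. -/
def abelianizationEnd (K : Type*) [Group K] :
    MulAut K →* AddMonoid.End (Additive (Abelianization K)) where
  toFun σ := MonoidHom.toAdditive (Abelianization.map σ.toMonoidHom)
  map_one' := by
    refine AddMonoidHom.ext fun x => ?_
    obtain ⟨k, rfl⟩ := QuotientGroup.mk_surjective (s := _root_.commutator K) x.toMul
    rfl
  map_mul' σ τ := by
    refine AddMonoidHom.ext fun x => ?_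
    obtain ⟨k, rfl⟩ := QuotientGroup.mk_surjective (s := _root_.commutator K) x.toMul
    rfl

/-- If `B/Z` has rank at least 2, a `p'`-group normalized by `B` is generated by
its elements centralized by some element of `B \ Z`. -/
theorem le_of_forall_commute_mem [Finite G] {p : ℕ} (hp : p.Prime) {Z : Subgroup G}
    (hB : IsElementaryAbelian p ↥B) (hZ : ∀ x ∈ B, ¬ B ≤ Z ⊔ Subgroup.zpowers x) (S : Subgroup G)
    (K : Subgroup G) (hK : ¬ p ∣ Nat.card ↥K) (hBK : B ≤ Subgroup.normalizer (K : Set G))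
    (hS : ∀ a ∈ B, a ∉ Z → ∀ k ∈ K, a * k = k * a → k ∈ S) : K ≤ S := by
  induction hn : Nat.card ↥K using Nat.strong_induction_on generalizing K with
  | _ n ih =>
  subst hn
  have step : ∀ H < K, B ≤ Subgroup.normalizer (H : Set G) → H ≤ S := by
    intro H hH hBH
    refine ih (Nat.card ↥H) ?_ H (fun hd => hK (hd.trans (Subgroup.card_dvd_of_le hH.le))) hBH
      (fun a ha haZ k hk => hS a ha haZ k (hH.le hk)) rfl
    exact Set.Finite.card_lt_card (Set.toFinite _) hH
  by_cases hD : ⁅K, K⁆ = K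
  · by_cases hbot : K = ⊥
    · rw [hbot]
      exact bot_le
    have : Nontrivial ↥K := (Subgroup.nontrivial_iff_ne_bot K).2 hbot
    have hcard : Nat.card ↥K ∣ Nat.card (S.subgroupOf K) := by
      rw [Nat.dvd_iff_prime_pow_dvd_dvd]
      intro q k hq hqk
      have := Fact.mk hq
      obtain ⟨P, hP⟩ := exists_sylow_le_normalizer (q := q) hp hB.isPGroup hK hBK
      have hlt : (P : Subgroup ↥K).map K.subtype < K := by
        refine lt_of_le_of_ne (Subgroup.map_subtype_le _) fun he => ?_
        have htop : (P : Subgroup ↥K) = ⊤ := by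
          rw [← Subgroup.map_subtype_inj (H := K), he, ← MonoidHom.range_eq_map, K.range_subtype]
        have hq : IsPGroup q ↥K := by
          have := P.isPGroup'
          rw [htop] at this
          exact this.of_equiv Subgroup.topEquiv
        have := hq.isNilpotent
        have hlt := Group.IsSolvable.commutator_lt_top_of_nontrivial ↥K
        rw [← Subgroup.map_subtype_lt_map_subtype, Subgroup.map_subtype_commutator, hD,
          ← MonoidHom.range_eq_map, K.range_subtype] at hlt
        exact lt_irrefl _ hlt
      have hPS : (P : Subgroup ↥K) ≤ S.subgroupOf K := Subgroup.map_le_iff_le_comap.1 (step _ hlt hP)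
      refine dvd_trans ?_ (Subgroup.card_dvd_of_le hPS)
      rw [P.card_eq_multiplicity]
      exact pow_dvd_pow q ((hq.pow_dvd_iff_le_factorization Nat.card_pos.ne').1 hqk)
    have := Subgroup.eq_top_of_card_eq (S.subgroupOf K)
      (Nat.dvd_antisymm (Subgroup.card_subgroup_dvd_card _) hcard)
    exact Subgroup.subgroupOf_eq_top.1 this
  · have hDS : ⁅K, K⁆ ≤ S := by
      refine step _ (lt_of_le_of_ne (Subgroup.commutator_le_self K) hD) fun b hb => ?_
      rw [Subgroup.mem_normalizer_iff_map_conj_eq, Subgroup.map_commutator,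
        Subgroup.mem_normalizer_iff_map_conj_eq.1 (hBK hb)]
    let ρ := (abelianizationEnd ↥K).comp (conjAction hBK)
    have hcardW : ¬ p ∣ Nat.card (Additive (Abelianization ↥K)) := fun hd =>
      hK (hd.trans (Subgroup.card_quotient_dvd_card _))
    have htop := addSubgroup_eq_top_of_fixedPoints hp hcardW ρ hB (Z := Z.subgroupOf B) (by
      rintro ⟨x, hx⟩ he
      apply hZ x hx
      have := congrArg (Subgroup.map B.subtype) he
      rw [Subgroup.map_sup, Subgroup.subgroupOf_map_subtype, MonoidHom.map_zpowers,
        ← MonoidHom.range_eq_map, B.range_subtype] at this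
      exact this.ge.trans (sup_le_sup_right inf_le_left _))
      (Subgroup.toAddSubgroup ((S.subgroupOf K).map Abelianization.of)) (by
      intro a ha v hv
      obtain ⟨k, rfl⟩ : ∃ k : ↥K, Additive.ofMul (Abelianization.of k) = v :=
        QuotientGroup.mk_surjective (s := _root_.commutator ↥K) v
      obtain ⟨k', hk', hfix⟩ := exists_fixed_of_abelianization hp hK (conjAction hBK a)
        (by rw [← map_pow, hB.2, map_one]) k hv
      refine ⟨k', ?_, hk'⟩
      refine hS a a.2 ha k' k'.2 ?_
      have := congrArg Subtype.val hfix
      rwa [coe_conjAction, mul_inv_eq_iff_eq_mul] at this)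
    intro k hk
    have : Additive.ofMul (Abelianization.of (⟨k, hk⟩ : ↥K)) ∈
      Subgroup.toAddSubgroup ((S.subgroupOf K).map Abelianization.of) := htop ▸ AddSubgroup.mem_top _
    obtain ⟨k', hk', he⟩ := this
    have hmem : (k' : ↥K)⁻¹ * ⟨k, hk⟩ ∈ _root_.commutator ↥K := QuotientGroup.eq.1 he
    have h2 : ((k'⁻¹ * ⟨k, hk⟩ : ↥K) : G) ∈ S := by
      apply hDS
      rw [← Subgroup.map_subtype_commutator]
      exact ⟨_, hmem, rfl⟩
    have h3 := S.mul_mem hk' h2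
    simpa using h3

end

end

/-! ### Conjugacy and connectivity for coprime extensions -/

section

variable {G : Type*} [Group G] {p : ℕ}

theorem mem_conjSub {g x : G} {L : Subgroup G} : x ∈ conjSub g L ↔ g⁻¹ * x * g ∈ L := by
  constructor
  · rintro ⟨y, hy, rfl⟩
    simpa [mul_assoc] using hy
  · exact fun h => ⟨_, h, by simp [mul_assoc]⟩

theorem conjSub_mul (g h : G) (L : Subgroup G) : conjSub (g * h) L = conjSub g (conjSub h L) := by
  ext x
  simp [mem_conjSub, mul_assoc]

theorem conjSub_one (L : Subgroup G) : conjSub 1 L = L := by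
  ext x
  simp [mem_conjSub]

theorem conjSub_mono (g : G) {L L' : Subgroup G} (h : L ≤ L') : conjSub g L ≤ conjSub g L' :=
  Subgroup.map_mono h

theorem conjSub_of_forall_commute {g : G} {L : Subgroup G} (h : ∀ x ∈ L, x * g = g * x) :
    conjSub g L = L := by
  have key : ∀ x ∈ L, x ∈ conjSub g L := fun x hx => by
    rwa [mem_conjSub, mul_assoc, h x hx, inv_mul_cancel_left]
  refine le_antisymm ?_ key
  rintro _ ⟨x, hx, rfl⟩
  simpa [← h x hx] using hx

theorem conjSub_eq_of_normal (g : G) (L : Subgroup G) [hL : L.Normal] : conjSub g L = L := by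
  ext x
  rw [mem_conjSub]
  exact ⟨fun h => by simpa [mul_assoc] using hL.conj_mem _ h g,
    fun h => by simpa using hL.conj_mem _ h g⁻¹⟩

theorem card_conjSub (g : G) (L : Subgroup G) : Nat.card ↥(conjSub g L) = Nat.card ↥L :=
  Subgroup.card_map_of_injective (MulAut.conj g).injective

theorem conjSub_ne_bot {g : G} {L : Subgroup G} (h : L ≠ ⊥) : conjSub g L ≠ ⊥ := by
  rwa [conjSub, Ne, Subgroup.map_eq_bot_iff_of_injective _ (MulAut.conj g).injective]

theorem IsElementaryAbelian.of_injective {H H' : Type*} [Group H] [Group H'] (f : H →* H')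
    (hf : Function.Injective f) (h : IsElementaryAbelian p H') : IsElementaryAbelian p H :=
  ⟨fun a b => hf (by rw [map_mul, map_mul, h.1]), fun a => hf (by rw [map_pow, h.2, map_one])⟩

theorem IsElementaryAbelian.of_surjective {H H' : Type*} [Group H] [Group H'] (f : H →* H')
    (hf : Function.Surjective f) (h : IsElementaryAbelian p H) : IsElementaryAbelian p H' := by
  refine ⟨fun a b => ?_, fun a => ?_⟩
  · obtain ⟨a, rfl⟩ := hf a
    obtain ⟨b, rfl⟩ := hf b
    rw [← map_mul, h.1, map_mul]
  · obtain ⟨a, rfl⟩ := hf a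
    rw [← map_pow, h.2, map_one]

theorem IsElementaryAbelian.mono {H K : Subgroup G} (hK : IsElementaryAbelian p ↥K) (h : H ≤ K) :
    IsElementaryAbelian p ↥H :=
  hK.of_injective _ (Subgroup.inclusion_injective h)

theorem IsElementaryAbelian.map {G' : Type*} [Group G'] {H : Subgroup G}
    (hH : IsElementaryAbelian p ↥H) (f : G →* G') : IsElementaryAbelian p ↥(H.map f) :=
  hH.of_surjective _ (f.subgroupMap_surjective H)

theorem IsElementaryAbelian.comm {H : Subgroup G} (hH : IsElementaryAbelian p ↥H) {x y : G}
    (hx : x ∈ H) (hy : y ∈ H) : x * y = y * x :=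
  congrArg Subtype.val (hH.1 ⟨x, hx⟩ ⟨y, hy⟩)

theorem IsElementaryAbelian.pow_eq_one {H : Subgroup G} (hH : IsElementaryAbelian p ↥H) {x : G}
    (hx : x ∈ H) : x ^ p = 1 :=
  congrArg Subtype.val (hH.2 ⟨x, hx⟩)

theorem IsElementaryAbelian.conjSub {H : Subgroup G} (hH : IsElementaryAbelian p ↥H) (g : G) :
    IsElementaryAbelian p ↥(conjSub g H) :=
  hH.map _

theorem disjoint_of_isPGroup_of_not_dvd [Finite G] (hp : p.Prime) {B K : Subgroup G}
    (hB : IsPGroup p ↥B) (hK : ¬ p ∣ Nat.card ↥K) : B ⊓ K = ⊥ := by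
  have := Fact.mk hp
  obtain ⟨n, hn⟩ := hB.exists_card_eq
  refine (Subgroup.disjoint_of_coprime_natCard ?_).eq_bot
  rw [hn]
  exact ((Nat.Prime.coprime_iff_not_dvd hp).2 hK).pow_left n

theorem exists_le_conjSub_of_sup_eq_top [Finite G] (hp : p.Prime) {B K z : Subgroup G} [K.Normal]
    (hB : IsPGroup p ↥B) (hK : ¬ p ∣ Nat.card ↥K) (htop : B ⊔ K = ⊤) (hz : IsPGroup p ↥z) :
    ∃ k ∈ K, z ≤ conjSub k B := by
  have := Fact.mk hp
  have hidx : ¬ p ∣ B.index := by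
    intro hdvd
    have h1 : K.index ∣ Nat.card ↥B := by
      rw [← Subgroup.relIndex_top_right, ← htop, Subgroup.relIndex_sup_right]
      exact Subgroup.relIndex_dvd_card _ _
    obtain ⟨n, hn⟩ := hB.exists_card_eq
    have h2 : p ^ (n + 1) ∣ Nat.card ↥K * K.index := by
      rw [K.card_mul_index, ← B.card_mul_index, hn, pow_succ]
      exact mul_dvd_mul_left _ hdvd
    have h3 := (((Nat.Prime.coprime_iff_not_dvd hp).2 hK).pow_left (n + 1)).dvd_of_dvd_mul_left h2
    have h4 := h3.trans h1
    rw [hn, Nat.pow_dvd_pow_iff_le_right hp.one_lt] at h4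
    omega
  obtain ⟨Q, hQ⟩ := hz.exists_le_sylow
  obtain ⟨g, hg⟩ := MulAction.exists_smul_eq G (hB.toSylow hidx) Q
  have hg' : g ∈ K ⊔ B := by
    rw [sup_comm, htop]
    trivial
  rw [Subgroup.mem_sup_of_normal_left] at hg'
  obtain ⟨k, hk, b, hb, rfl⟩ := hg'
  refine ⟨k, hk, fun x hx => ?_⟩
  have hx' := hQ hx
  rw [← hg, Sylow.coe_subgroup_smul] at hx'
  obtain ⟨y, hy, rfl⟩ := hx'
  have hy' : y ∈ B := hy
  rw [mem_conjSub]
  have : k⁻¹ * ((MulAut.conj (k * b)) y) * k = b * y * b⁻¹ := by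
    simp [mul_assoc]
  change k⁻¹ * ((MulAut.conj (k * b)) y) * k ∈ B
  rw [this]
  exact B.mul_mem (B.mul_mem hb hy') (B.inv_mem hb)

theorem exists_le_conjSub [Finite G] (hp : p.Prime) {B K z : Subgroup G}
    (hB : IsPGroup p ↥B) (hK : ¬ p ∣ Nat.card ↥K) (hBK : B ≤ Subgroup.normalizer (K : Set G))
    (hz : IsPGroup p ↥z) (hzBK : z ≤ B ⊔ K) : ∃ k ∈ K, z ≤ conjSub k B := by
  have hn : (K.subgroupOf (B ⊔ K)).Normal :=
    (Subgroup.normal_subgroupOf_iff_le_normalizer le_sup_right).2 (sup_le hBK Subgroup.le_normalizer)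
  obtain ⟨k, hk, hzk⟩ := exists_le_conjSub_of_sup_eq_top hp (B := B.subgroupOf (B ⊔ K))
    (K := K.subgroupOf (B ⊔ K)) (z := z.subgroupOf (B ⊔ K))
    (hB.of_equiv (Subgroup.subgroupOfEquivOfLe le_sup_left).symm)
    (by rwa [Nat.card_congr (Subgroup.subgroupOfEquivOfLe le_sup_right).toEquiv])
    (by rw [← Subgroup.subgroupOf_sup le_sup_left le_sup_right, Subgroup.subgroupOf_self])
    (hz.of_equiv (Subgroup.subgroupOfEquivOfLe hzBK).symm)
  refine ⟨k, hk, fun x hx => ?_⟩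
  have := hzk (show (⟨x, hzBK hx⟩ : ↥(B ⊔ K)) ∈ z.subgroupOf (B ⊔ K) from hx)
  rw [mem_conjSub] at this ⊢
  exact this

end

section
variable {G : Type} [Group G] {p : ℕ}

open Pointwise in
theorem IsElementaryAbelian.not_le_sup_zpowers [Finite G] (hp : p.Prime) {B Z : Subgroup G}
    (hB : IsElementaryAbelian p ↥B) (hZB : Z ≤ B) (hcard : p * Nat.card ↥Z < Nat.card ↥B)
    {x : G} (hx : x ∈ B) : ¬ B ≤ Z ⊔ Subgroup.zpowers x := by
  intro hle
  have hn : Z ≤ Subgroup.normalizer (Subgroup.zpowers x : Set G) := by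
    intro z hz
    refine Subgroup.centralizer_le_normalizer _ ?_
    rw [Subgroup.mem_centralizer_iff]
    rintro _ ⟨n, rfl⟩
    exact ((show Commute z x from hB.comm (hZB hz) hx).zpow_right n).symm
  have h1 : Nat.card ↥(Z ⊔ Subgroup.zpowers x) ≤ Nat.card ↥Z * Nat.card ↥(Subgroup.zpowers x) := by
    have h := Set.natCard_mul_le (s := (Z : Set G)) (t := (Subgroup.zpowers x : Set G))
    rwa [← Subgroup.coe_mul_of_left_le_normalizer_right _ _ hn] at h
  have h2 : Nat.card ↥(Subgroup.zpowers x) ≤ p := by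
    rw [Nat.card_zpowers]
    exact orderOf_le_of_pow_eq_one hp.pos (hB.pow_eq_one hx)
  have h3 := Subgroup.card_le_of_le hle
  have := Nat.mul_le_mul_left (Nat.card ↥Z) h2
  rw [mul_comm p] at hcard
  omega

theorem isPosetConnected_setOf_lt [Finite G] (hp : p.Prime) {B M Z : Subgroup G}
    (hB : IsElementaryAbelian p ↥B) (hM : ¬ p ∣ Nat.card ↥M)
    (hBM : B ≤ Subgroup.normalizer (M : Set G)) (hZB : Z ≤ B)
    (hcard : p * Nat.card ↥Z < Nat.card ↥B) :
    IsPosetConnected {z : Subgroup G | IsElementaryAbelian p ↥z ∧ z ≤ B ⊔ M ∧ Z < z} := by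
  set K : Subgroup G := M ⊓ Subgroup.centralizer (Z : Set G) with hKdef
  set W := {z : Subgroup G | IsElementaryAbelian p ↥z ∧ z ≤ B ⊔ M ∧ Z < z} with hW
  have hZltB : Z < B := by
    refine lt_of_le_of_ne hZB ?_
    rintro rfl
    have := Nat.mul_le_mul_right (Nat.card ↥Z) hp.one_le
    omega
  have hK : ¬ p ∣ Nat.card ↥K := fun h => hM (h.trans (Subgroup.card_dvd_of_le inf_le_left))
  have hcomm : ∀ k ∈ K, ∀ x ∈ Z, x * k = k * x := fun k hk x hx =>
    Subgroup.mem_centralizer_iff.1 hk.2 x hx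
  have hKM : ∀ k ∈ K, conjSub k (B ⊔ M) = B ⊔ M := fun k hk =>
    (Subgroup.mem_normalizer_iff_map_conj_eq.1
      (Subgroup.le_normalizer (le_sup_right (a := B) (hk.1))) :)
  have hWconj : ∀ k ∈ K, ∀ z ∈ W, conjSub k z ∈ W := by
    rintro k hk z ⟨hz, hzB, hZz⟩
    refine ⟨hz.conjSub k, ?_, ?_⟩
    · rw [← hKM k hk]
      exact conjSub_mono k hzB
    · rw [← conjSub_of_forall_commute (hcomm k hk)]
      exact (Subgroup.map_lt_map_iff_of_injective (MulAut.conj k).injective).2 hZz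
  have hBK : B ≤ Subgroup.normalizer (K : Set G) := by
    refine le_trans (le_inf hBM ?_) Subgroup.inf_normalizer_le_normalizer_inf
    refine le_trans ?_ Subgroup.le_normalizer
    intro b hb
    exact Subgroup.mem_centralizer_iff.2 fun x hx => hB.comm (hZB hx) hb
  have hBW : B ∈ W := ⟨hB, le_sup_left, hZltB⟩
  have hle : ∀ z ∈ W, ∃ k ∈ K, z ≤ conjSub k B := by
    rintro z ⟨hz, hzB, hZz⟩
    refine exists_le_conjSub hp hB.isPGroup hK hBK hz.isPGroup fun x hx => ?_
    have hx' := hzB hx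
    rw [← SetLike.mem_coe, Subgroup.coe_mul_of_left_le_normalizer_right _ _ hBM] at hx'
    obtain ⟨b, hb, m, hm, rfl⟩ := hx'
    refine Subgroup.mul_mem_sup hb ⟨hm, Subgroup.mem_centralizer_iff.2 fun y hy => ?_⟩
    have h1 := hz.comm (hZz.le hy) hx
    have h2 := hB.comm (hZB hy) hb
    beta_reduce at h1
    rw [← mul_assoc, h2, mul_assoc, mul_assoc] at h1
    exact mul_left_cancel h1
  let S : Subgroup G :=
    { carrier := {k | k ∈ K ∧ ∀ φ : Subgroup G → Prop,
        (∀ x ∈ W, ∀ y ∈ W, x ≤ y → (φ x ↔ φ y)) → (φ (conjSub k B) ↔ φ B)}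
      mul_mem' := by
        rintro k l ⟨hk, hk'⟩ ⟨hl, hl'⟩
        refine ⟨K.mul_mem hk hl, fun φ hφ => ?_⟩
        rw [conjSub_mul, ← hk' φ hφ]
        exact hl' (fun z => φ (conjSub k z)) fun x hx y hy hxy =>
          hφ _ (hWconj k hk x hx) _ (hWconj k hk y hy) (conjSub_mono k hxy)
      one_mem' := ⟨K.one_mem, fun φ _ => by rw [conjSub_one]⟩
      inv_mem' := by
        rintro k ⟨hk, hk'⟩
        refine ⟨K.inv_mem hk, fun φ hφ => ?_⟩
        have := hk' (fun z => φ (conjSub k⁻¹ z)) fun x hx y hy hxy =>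
          hφ _ (hWconj _ (K.inv_mem hk) x hx) _ (hWconj _ (K.inv_mem hk) y hy) (conjSub_mono _ hxy)
        rw [← conjSub_mul, inv_mul_cancel, conjSub_one] at this
        exact this.symm }
  have hKS : K ≤ S := by
    refine le_of_forall_commute_mem hp hB (fun x hx => hB.not_le_sup_zpowers hp hZB hcard hx)
      S K hK hBK fun a ha haZ k hk hak => ⟨hk, fun φ hφ => ?_⟩
    have hY : Z ⊔ Subgroup.zpowers a ≤ B := sup_le hZB (by simpa using ha)
    have hYW : Z ⊔ Subgroup.zpowers a ∈ W := by
      refine ⟨hB.mono hY, hY.trans le_sup_left, lt_of_le_of_ne le_sup_left fun h => haZ ?_⟩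
      rw [h]
      exact le_sup_right (a := Z) (Subgroup.mem_zpowers a)
    have hY' : Z ⊔ Subgroup.zpowers a ≤ conjSub k B := by
      refine sup_le ?_ ?_
      · rw [← conjSub_of_forall_commute (hcomm k hk)]
        exact conjSub_mono k hZB
      · rw [Subgroup.zpowers_le, mem_conjSub, mul_assoc, hak, inv_mul_cancel_left]
        exact ha
    rw [← hφ _ hYW _ (hWconj k hk B hBW) hY', hφ _ hYW _ hBW hY]
  refine ⟨⟨B, hBW⟩, fun φ hφ => ?_⟩
  have key : ∀ z ∈ W, (φ z ↔ φ B) := by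
    intro z hz
    obtain ⟨k, hk, hzk⟩ := hle z hz
    rw [hφ z hz _ (hWconj k hk B hBW) hzk]
    exact (hKS hk).2 φ hφ
  exact fun x hx y hy h => (key y hy).2 ((key x hx).1 h)
end

/-! ### The Quillen poset of a coprime extension by a rank three group -/

section

variable {G : Type} [Group G] {p : ℕ}

theorem IsElementaryAbelian.sup_zpowers {z : Subgroup G} (hz : IsElementaryAbelian p ↥z) {a : G}
    (ha : a ^ p = 1) (hc : ∀ x : G, a * x = x * a) :
    IsElementaryAbelian p ↥(z ⊔ Subgroup.zpowers a) := by
  have hc' : ∀ (n : ℤ) (x : G), Commute (a ^ n) x := fun n x => (show Commute a x from hc x).zpow_left n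
  have hn : (Subgroup.zpowers a).Normal := ⟨by
    rintro _ ⟨n, rfl⟩ g
    exact ⟨n, by beta_reduce; rw [← (hc' n g).eq, mul_inv_cancel_right]⟩⟩
  have key : ∀ x ∈ z ⊔ Subgroup.zpowers a, ∃ y ∈ z, ∃ n : ℤ, y * a ^ n = x := fun x hx => by
    obtain ⟨y, hy, _, ⟨n, rfl⟩, h⟩ := Subgroup.mem_sup_of_normal_right.1 hx
    exact ⟨y, hy, n, h⟩
  refine ⟨fun x y => Subtype.ext ?_, fun x => Subtype.ext ?_⟩
  · obtain ⟨u, hu, m, hm⟩ := key x x.2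
    obtain ⟨v, hv, n, hn⟩ := key y y.2
    rw [Subgroup.coe_mul, Subgroup.coe_mul, ← hm, ← hn]
    have huv : Commute u v := hz.comm hu hv
    exact (((huv.mul_right (hc' n u).symm)).mul_left (hc' m _)).eq
  · obtain ⟨u, hu, m, hm⟩ := key x x.2
    rw [Subgroup.coe_pow, ← hm, (hc' m u).symm.mul_pow, hz.pow_eq_one hu, ← zpow_natCast,
      ← zpow_mul, mul_comm, zpow_mul, zpow_natCast, ha, one_zpow, mul_one, Subgroup.coe_one]

theorem trivialH1_apSet_of_central {a : G} (ha1 : a ≠ 1) (ha : a ^ p = 1)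
    (hc : ∀ x : G, a * x = x * a) : TrivialH1 (apSet p G) := by
  have hne : Subgroup.zpowers a ≠ ⊥ := by rwa [Ne, Subgroup.zpowers_eq_bot]
  have hE : IsElementaryAbelian p ↥(Subgroup.zpowers a) := by
    have h : IsElementaryAbelian p ↥(⊥ : Subgroup G) :=
      ⟨fun a b => Subsingleton.elim _ _, fun a => Subsingleton.elim _ _⟩
    rw [← bot_sup_eq (Subgroup.zpowers a)]
    exact h.sup_zpowers ha hc
  refine TrivialH1.of_isConicallyContractible (fun z => z ⊔ Subgroup.zpowers a)
    (Subgroup.zpowers a) ⟨hne, hE⟩ (fun z hz => ⟨?_, hz.2.sup_zpowers ha hc⟩)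
    (fun _ _ => le_sup_left) (fun _ _ => le_sup_right) (fun x _ y _ h => sup_le_sup_right h _)
  exact ne_bot_of_le_ne_bot hne le_sup_right

theorem trivialH1_apSetIn {K : Subgroup G} (h : TrivialH1 (apSet p ↥K)) :
    TrivialH1 (apSetIn p K) := by
  refine h.of_retract (fun x => x.subgroupOf K) (fun y => y.map K.subtype) ?_ ?_ ?_ ?_ ?_
  · rintro x ⟨hx, hE, hK⟩
    refine ⟨fun h => hx ?_, hE.of_injective (Subgroup.subgroupOfEquivOfLe hK).toMonoidHom
      (Subgroup.subgroupOfEquivOfLe hK).injective⟩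
    rw [← Subgroup.map_subgroupOf_eq_of_le hK, h, Subgroup.map_bot]
  · rintro y ⟨hy, hE⟩
    refine ⟨?_, hE.map _, Subgroup.map_subtype_le y⟩
    rwa [Ne, Subgroup.map_eq_bot_iff_of_injective _ K.subtype_injective]
  · exact fun x _ y _ h => Subgroup.comap_mono h
  · exact fun x _ y _ h => Subgroup.map_mono h
  · exact fun x hx => Subgroup.map_subgroupOf_eq_of_le hx.2.2

theorem card_map_mk'_of_inf_eq_bot {M H : Subgroup G} [M.Normal] (h : H ⊓ M = ⊥) :
    Nat.card ↥(H.map (QuotientGroup.mk' M)) = Nat.card ↥H := by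
  refine (Nat.card_congr (Equiv.ofBijective ((QuotientGroup.mk' M).subgroupMap H) ⟨?_,
    (QuotientGroup.mk' M).subgroupMap_surjective H⟩)).symm
  rw [injective_iff_map_eq_one]
  intro x hx
  have hx' : QuotientGroup.mk' M x = 1 := congrArg Subtype.val hx
  rw [QuotientGroup.mk'_apply, QuotientGroup.eq_one_iff] at hx'
  exact Subtype.ext (Subgroup.mem_bot.1 (h ▸ ⟨x.2, hx'⟩))

theorem comap_map_mk' {M H : Subgroup G} [M.Normal] :
    (H.map (QuotientGroup.mk' M)).comap (QuotientGroup.mk' M) = H ⊔ M := by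
  rw [Subgroup.comap_map_eq, QuotientGroup.ker_mk']

theorem setOf_map_le_eq_apSetIn {M H : Subgroup G} [M.Normal] :
    {x | x ∈ apSet p G ∧ x.map (QuotientGroup.mk' M) ≤ H.map (QuotientGroup.mk' M)} =
      apSetIn p (H ⊔ M) := by
  ext x
  change _ ∧ _ ↔ _ ∧ _ ∧ _
  rw [Subgroup.map_le_iff_le_comap, comap_map_mk', and_assoc.symm]
  rfl

theorem sq_le_card_of_lt [Finite G] (hp : p.Prime) {y z : Subgroup G} (hy : y ≠ ⊥)
    (hz : IsPGroup p ↥z) (h : y < z) : p ^ 2 ≤ Nat.card ↥z := by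
  have := Fact.mk hp
  obtain ⟨m, hm⟩ := (hz.to_le h.le).exists_card_eq
  obtain ⟨n, hn⟩ := hz.exists_card_eq
  have hlt : Nat.card ↥y < Nat.card ↥z := Set.Finite.card_lt_card (Set.toFinite _) h
  rw [hm, hn, Nat.pow_lt_pow_iff_right hp.one_lt] at hlt
  have : m ≠ 0 := by
    rintro rfl
    exact hy (Subgroup.eq_bot_of_card_eq _ hm)
  rw [hn]
  exact Nat.pow_le_pow_right hp.pos (by omega)

end

section
variable {G : Type} [Group G] {p : ℕ}

/-- `H¹` of the Quillen poset vanishes for all coprime extensions of a rank three elementary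
abelian group by a normal subgroup of order less than `n`. -/
def TrivialH1Below (p n : ℕ) : Prop :=
  ∀ (G : Type) [Group G] [Finite G] (A N : Subgroup G) [N.Normal], Nat.card ↥N < n →
    IsElementaryAbelian p ↥A → Nat.card ↥A = p ^ 3 → A ⊔ N = ⊤ → ¬ p ∣ Nat.card ↥N →
    TrivialH1 (apSet p G)

theorem TrivialH1Below.trivialH1_apSetIn {n : ℕ} (ih : TrivialH1Below p n) [Finite G]
    {A M : Subgroup G} [M.Normal] (hM : Nat.card ↥M < n) (hA : IsElementaryAbelian p ↥A)
    (hcard : Nat.card ↥A = p ^ 3) (hpM : ¬ p ∣ Nat.card ↥M) : TrivialH1 (apSetIn p (A ⊔ M)) := by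
  have hcM : Nat.card ↥(M.subgroupOf (A ⊔ M)) = Nat.card ↥M :=
    Nat.card_congr (Subgroup.subgroupOfEquivOfLe le_sup_right).toEquiv
  refine _root_.trivialH1_apSetIn
    (ih _ (A.subgroupOf (A ⊔ M)) (M.subgroupOf (A ⊔ M)) (by rwa [hcM]) ?_ ?_ ?_ (by rwa [hcM]))
  · exact hA.of_injective (Subgroup.subgroupOfEquivOfLe le_sup_left : _ ≃* ↥A).toMonoidHom
      (MulEquiv.injective _)
  · rwa [Nat.card_congr (Subgroup.subgroupOfEquivOfLe le_sup_left).toEquiv]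
  · rw [← Subgroup.subgroupOf_sup le_sup_left le_sup_right, Subgroup.subgroupOf_self]

theorem exists_lift_of_mem_apSet [Finite G] (hp : p.Prime) {A N M : Subgroup G} [N.Normal]
    [M.Normal] (hA : IsElementaryAbelian p ↥A) (htop : A ⊔ N = ⊤) (hN : ¬ p ∣ Nat.card ↥N)
    {y : Subgroup (G ⧸ M)} (hy : IsElementaryAbelian p ↥y) :
    ∃ (g : G) (B : Subgroup G), B ≤ conjSub g A ∧ B.map (QuotientGroup.mk' M) = y := by
  have hsurj := QuotientGroup.mk'_surjective M
  have : (N.map (QuotientGroup.mk' M)).Normal := Subgroup.Normal.map ‹_› _ hsurj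
  obtain ⟨k, -, hk⟩ := exists_le_conjSub_of_sup_eq_top hp
    (B := A.map (QuotientGroup.mk' M)) (K := N.map (QuotientGroup.mk' M))
    (hA.map _).isPGroup (fun h => hN (h.trans (Subgroup.card_map_dvd _ _)))
    (by rw [← Subgroup.map_sup, htop, Subgroup.map_top_of_surjective _ hsurj]) hy.isPGroup
  obtain ⟨g, rfl⟩ := hsurj k
  refine ⟨g, conjSub g A ⊓ y.comap (QuotientGroup.mk' M), inf_le_left, le_antisymm ?_ ?_⟩
  · exact (Subgroup.map_mono inf_le_right).trans (Subgroup.map_comap_le _ _)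
  · intro x hx
    obtain ⟨_, ⟨a, ha, rfl⟩, h⟩ := hk hx
    have h' : QuotientGroup.mk' M (g * a * g⁻¹) = x := by
      rw [map_mul, map_mul, map_inv]
      exact h
    refine ⟨g * a * g⁻¹, ⟨?_, ?_⟩, h'⟩
    · exact ⟨a, ha, rfl⟩
    · change QuotientGroup.mk' M (g * a * g⁻¹) ∈ y
      rwa [h']

theorem TrivialH1Below.trivialH1_apSet_of_normal {n : ℕ} (ih : TrivialH1Below p n) [Finite G]
    (hp : p.Prime) {A N M : Subgroup G} [N.Normal] [M.Normal] (hn : Nat.card ↥N ≤ n)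
    (hA : IsElementaryAbelian p ↥A) (hcard : Nat.card ↥A = p ^ 3) (htop : A ⊔ N = ⊤)
    (hN : ¬ p ∣ Nat.card ↥N) (hM : M ≠ ⊥) (hMN : M < N) : TrivialH1 (apSet p G) := by
  set π := QuotientGroup.mk' M with hπ
  have hsurj : Function.Surjective π := QuotientGroup.mk'_surjective M
  have hNn : (N.map π).Normal := Subgroup.Normal.map ‹_› _ hsurj
  have hpM : ¬ p ∣ Nat.card ↥M := fun h => hN (h.trans (Subgroup.card_dvd_of_le hMN.le))
  have hpN : ¬ p ∣ Nat.card ↥(N.map π) := fun h => hN (h.trans (Subgroup.card_map_dvd _ _))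
  have hcM : Nat.card ↥M < Nat.card ↥N := Set.Finite.card_lt_card (Set.toFinite _) hMN
  have hdisj : ∀ {x : Subgroup G}, IsElementaryAbelian p ↥x → x ⊓ M = ⊥ := fun hx =>
    disjoint_of_isPGroup_of_not_dvd hp hx.isPGroup hpM
  have hcardmap : ∀ {x : Subgroup G}, IsElementaryAbelian p ↥x →
      Nat.card ↥(x.map π) = Nat.card ↥x := fun hx => card_map_mk'_of_inf_eq_bot (hdisj hx)
  have hnmap : Nat.card ↥(N.map π) < Nat.card ↥N := by
    refine lt_of_le_of_ne (Nat.le_of_dvd Nat.card_pos (Subgroup.card_map_dvd _ _)) fun h => hM ?_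
    have hinj := (Nat.bijective_iff_surjective_and_card (π.subgroupMap N)).2
      ⟨π.subgroupMap_surjective N, h.symm⟩
    rw [eq_bot_iff]
    intro m hm
    have : (⟨m, hMN.le hm⟩ : ↥N) = 1 := hinj.1 (Subtype.ext (by
      rw [map_one]
      exact (QuotientGroup.eq_one_iff m).2 hm))
    exact congrArg Subtype.val this
  have htop' : A.map π ⊔ N.map π = ⊤ := by
    rw [← Subgroup.map_sup, htop, Subgroup.map_top_of_surjective _ hsurj]
  have hT : TrivialH1 (apSet p (G ⧸ M)) :=
    ih (G ⧸ M) (A.map π) (N.map π) (hnmap.trans_le hn) (hA.map π) (by rw [hcardmap hA, hcard])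
      htop' hpN
  refine TrivialH1.of_fibres (W := {y | y ∈ apSet p (G ⧸ M) ∧ p ^ 2 ≤ Nat.card ↥y})
    (fun x => x.map π) hT ?_ (fun x _ y _ h => Subgroup.map_mono h) ?_ ?_ ?_ ?_
  · rintro x ⟨hx, hE⟩
    refine ⟨fun h => hx ?_, hE.map π⟩
    refine Subgroup.eq_bot_of_card_eq _ ?_
    rw [← hcardmap hE, h, Subgroup.card_bot]
  · rintro y ⟨hy, hE⟩
    by_cases hyc : p ^ 2 ≤ Nat.card ↥y
    · exact isPosetConnected_of_isLeast (b := y) ⟨⟨⟨⟨hy, hE⟩, hyc⟩, le_rfl⟩, fun z hz => hz.2⟩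
    · obtain ⟨g, B, hB, rfl⟩ := exists_lift_of_mem_apSet hp (M := M) hA htop hN hE
      have h := isPosetConnected_setOf_lt hp (B := (conjSub g A).map π) (M := N.map π)
        (Z := B.map π) ((hA.conjSub g).map π) hpN Subgroup.le_normalizer_of_normal
        (Subgroup.map_mono hB) (by
          rw [hcardmap (hA.conjSub g), card_conjSub, hcard, pow_succ', mul_lt_mul_iff_right₀ hp.pos]
          exact not_le.1 hyc)
      have htop'' : (conjSub g A).map π ⊔ N.map π = ⊤ := by
        rw [← Subgroup.map_sup, ← conjSub_eq_of_normal g N, conjSub, conjSub, ← Subgroup.map_sup,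
          htop, Subgroup.map_top_of_surjective _ (MulAut.conj g).surjective,
          Subgroup.map_top_of_surjective _ hsurj]
      convert h using 1
      ext w
      constructor
      · rintro ⟨⟨⟨hw, hwE⟩, hwc⟩, hle⟩
        refine ⟨hwE, by rw [htop'']; exact le_top, lt_of_le_of_ne hle ?_⟩
        rintro rfl
        exact hyc hwc
      · rintro ⟨hwE, -, hlt⟩
        exact ⟨⟨⟨ne_bot_of_gt hlt, hwE⟩, sq_le_card_of_lt hp hy hwE.isPGroup hlt⟩, hlt.le⟩
  · rintro y ⟨hy, hE⟩
    obtain ⟨g, B, hB, rfl⟩ := exists_lift_of_mem_apSet hp (M := M) hA htop hN hE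
    refine ⟨B, ⟨?_, (hA.conjSub g).mono hB⟩, le_rfl⟩
    rintro rfl
    exact hy (Subgroup.map_bot _)
  · rintro y ⟨⟨hy, hE⟩, hyc⟩
    obtain ⟨g, B, hB, rfl⟩ := exists_lift_of_mem_apSet hp (M := M) hA htop hN hE
    have hBE := (hA.conjSub g).mono hB
    rw [setOf_map_le_eq_apSetIn]
    have h := isPosetConnected_setOf_lt hp (Z := ⊥) hBE hpM Subgroup.le_normalizer_of_normal bot_le
      (by
        rw [hcardmap hBE] at hyc
        rw [Subgroup.card_bot, mul_one]
        exact lt_of_lt_of_le (by nlinarith [hp.two_le]) hyc)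
    convert h using 1
    ext w
    rw [Set.mem_ofPred_eq, bot_lt_iff_ne_bot]
    exact ⟨fun h => ⟨h.2.1, h.2.2, h.1⟩, fun h => ⟨h.2.2, h.1, h.2.1⟩⟩
  · rintro y ⟨⟨hy, hE⟩, hyc⟩
    obtain ⟨g, B, hB, rfl⟩ := exists_lift_of_mem_apSet hp (M := M) hA htop hN hE
    refine ⟨(conjSub g A).map π, Subgroup.map_mono hB, ?_⟩
    rw [setOf_map_le_eq_apSetIn]
    exact ih.trivialH1_apSetIn (hcM.trans_le hn) (hA.conjSub g) (by rw [card_conjSub, hcard]) hpM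

end

section
variable {G : Type} [Group G] {p : ℕ}

theorem normal_of_sup_eq_top {A N M : Subgroup G} (htop : A ⊔ N = ⊤)
    (hA : A ≤ Subgroup.normalizer (M : Set G)) (hN : N ≤ Subgroup.normalizer (M : Set G)) :
    M.Normal := by
  rw [← Subgroup.normalizer_eq_top_iff, eq_top_iff, ← htop]
  exact sup_le hA hN

/-- `L` is minimal among the nontrivial subgroups of `N` normalized by `N`. -/
def IsMinimalNormalIn (N L : Subgroup G) : Prop :=
  L ≠ ⊥ ∧ L ≤ N ∧ N ≤ Subgroup.normalizer (L : Set G) ∧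
    ∀ L' : Subgroup G, L' ≠ ⊥ → L' ≤ L → N ≤ Subgroup.normalizer (L' : Set G) → L' = L

theorem exists_isMinimalNormalIn [Finite G] {N : Subgroup G} (hN : N ≠ ⊥) :
    ∃ L, IsMinimalNormalIn N L := by
  obtain ⟨L, hL⟩ := (Set.toFinite {L : Subgroup G | L ≠ ⊥ ∧ L ≤ N ∧
    N ≤ Subgroup.normalizer (L : Set G)}).exists_minimal ⟨N, hN, le_rfl, Subgroup.le_normalizer⟩
  exact ⟨L, hL.1.1, hL.1.2.1, hL.1.2.2, fun L' h1 h2 h3 =>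
    hL.eq_of_le ⟨h1, h2.trans hL.1.2.1, h3⟩ h2⟩

theorem le_normalizer_conjSub {N L : Subgroup G} [hNn : N.Normal]
    (hN : N ≤ Subgroup.normalizer (L : Set G)) (g : G) :
    N ≤ Subgroup.normalizer (conjSub g L : Set G) := by
  rw [Subgroup.le_normalizer_iff] at hN ⊢
  rintro n hn _ ⟨x, hx, rfl⟩
  refine ⟨_, hN (g⁻¹ * n * g) (by simpa using hNn.conj_mem n hn g⁻¹) x hx, ?_⟩
  simp [mul_assoc]

theorem IsMinimalNormalIn.conjSub {N L : Subgroup G} [N.Normal] (h : IsMinimalNormalIn N L)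
    (g : G) : IsMinimalNormalIn N (conjSub g L) := by
  obtain ⟨h1, h2, h3, h4⟩ := h
  refine ⟨conjSub_ne_bot h1, ?_, le_normalizer_conjSub h3 g, fun L' h1' h2' h3' => ?_⟩
  · rw [← conjSub_eq_of_normal g N]
    exact conjSub_mono g h2
  · have := h4 (_root_.conjSub g⁻¹ L') (conjSub_ne_bot h1')
      (by
        have := conjSub_mono g⁻¹ h2'
        rwa [← conjSub_mul, inv_mul_cancel, conjSub_one] at this)
      (le_normalizer_conjSub h3' _)
    rw [← this, ← conjSub_mul, mul_inv_cancel, conjSub_one]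

theorem IsMinimalNormalIn.commute {N K L : Subgroup G} (hK : IsMinimalNormalIn N K)
    (hL : IsMinimalNormalIn N L) (hne : K ≠ L) : ∀ x ∈ K, ∀ y ∈ L, x * y = y * x := by
  have hbot : K ⊓ L = ⊥ := by
    by_contra h
    have hn := (le_inf hK.2.2.1 hL.2.2.1).trans Subgroup.inf_normalizer_le_normalizer_inf
    exact hne ((hK.2.2.2 _ h inf_le_left hn).symm.trans (hL.2.2.2 _ h inf_le_right hn))
  intro x hx y hy
  have h1 : x * y * x⁻¹ * y⁻¹ ∈ K ⊓ L := by
    refine Subgroup.mem_inf.2 ⟨?_, ?_⟩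
    · have := (Subgroup.le_normalizer_iff.1 hK.2.2.1) y (hL.2.1 hy) _ (K.inv_mem hx)
      simpa only [mul_assoc] using K.mul_mem hx this
    · exact L.mul_mem ((Subgroup.le_normalizer_iff.1 hL.2.2.1) x (hK.2.1 hx) _ hy) (L.inv_mem hy)
  rw [hbot, Subgroup.mem_bot, mul_inv_eq_one, mul_inv_eq_iff_eq_mul] at h1
  exact h1

theorem exists_ne_one_forall_commute [Finite G] (hp : p.Prime) {A N : Subgroup G} [hNn : N.Normal]
    (hA : IsElementaryAbelian p ↥A) (hcard : p < Nat.card ↥A) (htop : A ⊔ N = ⊤)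
    (hN : ¬ p ∣ Nat.card ↥N) (hN1 : N ≠ ⊥)
    (hmin : ∀ M : Subgroup G, M.Normal → M ≠ ⊥ → M ≤ N → M = N)
    (hab : ∀ x ∈ N, ∀ y ∈ N, x * y = y * x) : ∃ a ∈ A, a ≠ 1 ∧ ∀ n ∈ N, a * n = n * a := by
  by_contra! hcon
  refine hN1 (le_bot_iff.1 (le_of_forall_commute_mem hp (Z := ⊥) hA
    (fun x hx => hA.not_le_sup_zpowers hp bot_le (by simpa using hcard) hx) ⊥ N hN
    Subgroup.le_normalizer_of_normal fun a ha ha1 k hk hak => ?_))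
  by_contra hk1
  obtain ⟨n, hn, hna⟩ := hcon a ha ha1
  have hM : (N ⊓ Subgroup.centralizer {a}).Normal := by
    refine normal_of_sup_eq_top htop ?_ ?_
    · refine (le_inf Subgroup.le_normalizer_of_normal (le_trans ?_ Subgroup.le_normalizer)).trans
        Subgroup.inf_normalizer_le_normalizer_inf
      exact fun b hb => Subgroup.mem_centralizer_singleton_iff.2 (hA.comm hb ha)
    · rw [Subgroup.le_normalizer_iff]
      intro x hx y hy
      rwa [hab x hx y hy.1, mul_inv_cancel_right]
  have h := hmin _ hM (fun h => hk1 (by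
    rw [← h]
    exact ⟨hk, Subgroup.mem_centralizer_singleton_iff.2 hak.symm⟩)) inf_le_left
  rw [← h] at hn
  exact hna (Subgroup.mem_centralizer_singleton_iff.1 hn.2).symm

theorem centralizer_eq_bot_of_inf_eq_bot [Finite G] (hp : p.Prime) {A N : Subgroup G}
    [hNn : N.Normal] (hA : IsElementaryAbelian p ↥A) (htop : A ⊔ N = ⊤) (hN : ¬ p ∣ Nat.card ↥N)
    (hfaith : ∀ a ∈ A, (∀ n ∈ N, a * n = n * a) → a = 1)
    (hinf : N ⊓ Subgroup.centralizer (N : Set G) = ⊥) : Subgroup.centralizer (N : Set G) = ⊥ := by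
  rw [eq_bot_iff]
  intro x hx
  have hpow : x ^ p = 1 := by
    rw [← Subgroup.mem_bot, ← hinf]
    refine Subgroup.mem_inf.2 ⟨?_, Subgroup.pow_mem _ hx p⟩
    have hq : IsElementaryAbelian p ↥(A.map (QuotientGroup.mk' N)) := hA.map _
    have htop' : A.map (QuotientGroup.mk' N) = ⊤ := by
      have h := congrArg (Subgroup.map (QuotientGroup.mk' N)) htop
      rwa [Subgroup.map_sup, (Subgroup.map_eq_bot_iff N).2 (QuotientGroup.ker_mk' N).ge, sup_bot_eq,
        Subgroup.map_top_of_surjective _ (QuotientGroup.mk'_surjective N)] at h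
    rw [← QuotientGroup.eq_one_iff]
    exact hq.pow_eq_one (x := (x : G ⧸ N)) (by rw [htop']; trivial)
  have hz : IsPGroup p ↥(Subgroup.zpowers x) := by
    have := Fact.mk hp
    rintro ⟨_, n, rfl⟩
    refine ⟨1, Subtype.ext ?_⟩
    change (x ^ n) ^ p ^ 1 = 1
    rw [pow_one, ← zpow_natCast, ← zpow_mul, mul_comm, zpow_mul, zpow_natCast, hpow, one_zpow]
  obtain ⟨k, hk, hle⟩ := exists_le_conjSub_of_sup_eq_top hp hA.isPGroup hN htop hz
  have hxA := hle (Subgroup.mem_zpowers x)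
  rw [mem_conjSub, mul_assoc, ← Subgroup.mem_centralizer_iff.1 hx k hk, inv_mul_cancel_left] at hxA
  exact hfaith x hxA fun n hn => (Subgroup.mem_centralizer_iff.1 hx n hn).symm

theorem IsMinimalNormalIn.iSup_conjSub_eq {A N L : Subgroup G} [N.Normal]
    (h : IsMinimalNormalIn N L) (htop : A ⊔ N = ⊤)
    (hmin : ∀ M : Subgroup G, M.Normal → M ≠ ⊥ → M ≤ N → M = N) :
    (⨆ (K : Subgroup G) (_ : ∃ a ∈ A, K = _root_.conjSub a L), K) = N := by
  have hle : L ≤ ⨆ (K : Subgroup G) (_ : ∃ a ∈ A, K = _root_.conjSub a L), K :=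
    le_iSup₂_of_le L ⟨1, A.one_mem, (conjSub_one L).symm⟩ le_rfl
  refine hmin _ (normal_of_sup_eq_top htop ?_ ?_) (ne_bot_of_le_ne_bot h.1 hle) ?_
  · rw [Subgroup.le_normalizer_iff]
    intro b hb x hx
    have key : _root_.conjSub b (⨆ (K : Subgroup G) (_ : ∃ a ∈ A, K = _root_.conjSub a L), K) ≤
        ⨆ (K : Subgroup G) (_ : ∃ a ∈ A, K = _root_.conjSub a L), K := by
      rw [_root_.conjSub, Subgroup.map_iSup]
      refine iSup_le fun K => ?_
      rw [Subgroup.map_iSup]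
      refine iSup_le ?_
      rintro ⟨a, ha, rfl⟩
      refine le_iSup₂_of_le (_root_.conjSub (b * a) L) ⟨b * a, A.mul_mem hb ha, rfl⟩ ?_
      rw [conjSub_mul]
      rfl
    exact key ⟨x, hx, rfl⟩
  · refine le_trans (le_iInf fun K => le_trans (le_iInf ?_)
      (Subgroup.iInf_normalizer_le_normalizer_iSup _))
      (Subgroup.iInf_normalizer_le_normalizer_iSup _)
    rintro ⟨a, -, rfl⟩
    exact (h.conjSub a).2.2.1
  · refine iSup₂_le ?_
    rintro _ ⟨a, -, rfl⟩
    exact (h.conjSub a).2.1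

theorem IsMinimalNormalIn.aschbacherCore [Finite G] {A N L : Subgroup G} [hNn : N.Normal]
    (h : IsMinimalNormalIn N L) (hA : IsElementaryAbelian p ↥A) (htop : A ⊔ N = ⊤)
    (hN : ¬ p ∣ Nat.card ↥N)
    (hmin : ∀ M : Subgroup G, M.Normal → M ≠ ⊥ → M ≤ N → M = N)
    (hC : Subgroup.centralizer (N : Set G) = ⊥) : AschbacherCore p A N L := by
  have hsup := h.iSup_conjSub_eq htop hmin
  have hcomm : ∀ K K' : Subgroup G, (∃ a ∈ A, K = _root_.conjSub a L) →
      (∃ a ∈ A, K' = _root_.conjSub a L) → K ≠ K' → ∀ x ∈ K, ∀ y ∈ K', x * y = y * x := by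
    rintro _ _ ⟨a, -, rfl⟩ ⟨b, -, rfl⟩ hne
    exact (h.conjSub a).commute (h.conjSub b) hne
  have hLc : ∃ a ∈ A, L = _root_.conjSub a L := ⟨1, A.one_mem, (conjSub_one L).symm⟩
  have hcent : ∀ K : Subgroup G, (∃ a ∈ A, K = _root_.conjSub a L) → ∀ x ∈ K,
      (∀ y ∈ K, x * y = y * x) → x = 1 := by
    intro K hK x hx hxK
    have hle : N ≤ Subgroup.centralizer {x} := by
      rw [← hsup]
      refine iSup₂_le fun K' hK' y hy => Subgroup.mem_centralizer_singleton_iff.2 ?_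
      by_cases hKK : K = K'
      · subst hKK
        exact (hxK y hy).symm
      · exact (hcomm K K' hK hK' hKK x hx y hy).symm
    rw [← Subgroup.mem_bot, ← hC]
    exact Subgroup.mem_centralizer_iff.2 fun y hy => Subgroup.mem_centralizer_singleton_iff.1 (hle hy)
  have hnontriv : Nontrivial ↥L := (Subgroup.nontrivial_iff_ne_bot L).2 h.1
  refine ⟨hA, hNn, hC, htop, h.2.1, ?_, ⟨fun H hH => ?_⟩, ?_,
    fun hd => hN (hd.trans (Subgroup.card_dvd_of_le h.2.1)), hsup, hcomm, ?_⟩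
  · refine ⟨2, fun n => if n = 0 then L else if n = 1 then N else ⊤, by simp, by simp, ?_⟩
    intro i hi
    interval_cases i
    · exact ⟨by simpa using h.2.1, fun g hg x hx => by
        simp only [zero_add, one_ne_zero, if_false, if_true] at hg hx ⊢
        exact Subgroup.le_normalizer_iff.1 h.2.2.1 g hg x hx⟩
    · exact ⟨by simp, fun g _ x hx => by
        simp only [one_ne_zero, if_false, if_true] at hx ⊢
        exact hNn.conj_mem x hx g⟩
  · have hnorm : N ≤ Subgroup.normalizer (H.map L.subtype : Set G) := by
      rw [← hsup]
      refine iSup₂_le fun K hK => ?_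
      rw [Subgroup.le_normalizer_iff]
      rintro k hk _ ⟨x, hx, rfl⟩
      by_cases hKL : K = L
      · subst hKL
        exact ⟨_, hH.conj_mem x hx ⟨k, hk⟩, rfl⟩
      · rw [Subgroup.subtype_apply, hcomm K L hK hLc hKL k hk _ x.2, mul_inv_cancel_right]
        exact ⟨x, hx, rfl⟩
    by_cases hH1 : H = ⊥
    · exact .inl hH1
    · right
      have := h.2.2.2 (H.map L.subtype)
        (by rwa [Ne, Subgroup.map_eq_bot_iff_of_injective _ L.subtype_injective])
        (Subgroup.map_subtype_le H) hnorm
      rw [eq_top_iff]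
      intro x _
      have hx : (x : G) ∈ H.map L.subtype := this.ge x.2
      obtain ⟨y, hy, hyx⟩ := hx
      rwa [← Subtype.ext hyx]
  · by_contra! hab
    obtain ⟨x, hx⟩ := exists_ne (1 : ↥L)
    exact hx (Subtype.ext (hcent L hLc x x.2 fun y hy => congrArg Subtype.val (hab x ⟨y, hy⟩)))
  · intro K hK
    rw [eq_bot_iff]
    rintro x ⟨hxK, hxD⟩
    refine hcent K hK x hxK fun y hy => ?_
    have hle : (⨆ (K' : Subgroup G) (_ : (∃ a ∈ A, K' = _root_.conjSub a L) ∧ K' ≠ K), K') ≤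
        Subgroup.centralizer (K : Set G) := by
      refine iSup₂_le fun K' hK' z hz => Subgroup.mem_centralizer_iff.2 fun w hw => ?_
      exact hcomm K K' hK hK'.1 hK'.2.symm w hw z hz
    exact (Subgroup.mem_centralizer_iff.1 (hle hxD) y hy).symm

theorem trivialH1Below (hp : p.Prime) (hasch : AschbacherConjectureRank3 p) (n : ℕ) :
    TrivialH1Below p n := by
  induction n with
  | zero => exact fun G _ _ A N _ h => absurd h (Nat.not_lt_zero _)
  | succ n ih =>
    intro G _ _ A N hNn hn hA hcard htop hN
    by_cases hfaith : ∀ a ∈ A, (∀ n ∈ N, a * n = n * a) → a = 1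
    · by_cases hM : ∃ M : Subgroup G, M.Normal ∧ M ≠ ⊥ ∧ M < N
      · obtain ⟨M, hMn, hM1, hMN⟩ := hM
        exact ih.trivialH1_apSet_of_normal hp (Nat.lt_succ_iff.1 hn) hA hcard htop hN hM1 hMN
      · have hmin : ∀ M : Subgroup G, M.Normal → M ≠ ⊥ → M ≤ N → M = N := by
          intro M hMn hM1 hMN
          by_contra hne
          exact hM ⟨M, hMn, hM1, lt_of_le_of_ne hMN hne⟩
        have hAcard : p < Nat.card ↥A := by
          rw [hcard]
          exact lt_self_pow₀ hp.one_lt (by norm_num)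
        have hN1 : N ≠ ⊥ := by
          rintro rfl
          have h : A = ⊥ := by
            rw [eq_bot_iff]
            intro a ha
            refine hfaith a ha fun n hn => ?_
            rw [Subgroup.mem_bot.1 hn, mul_one, one_mul]
          rw [h, Subgroup.card_bot] at hAcard
          exact absurd hAcard (not_lt.2 hp.one_le)
        have hinf : N ⊓ Subgroup.centralizer (N : Set G) = ⊥ := by
          by_contra hne
          have h := hmin _ inferInstance hne inf_le_left
          obtain ⟨a, ha, ha1, hc⟩ := exists_ne_one_forall_commute hp hA hAcard htop hN hN1 hmin
            fun x hx y hy => (Subgroup.mem_centralizer_iff.1 (inf_eq_left.1 h hx) y hy).symm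
          exact ha1 (hfaith a ha hc)
        obtain ⟨L, hL⟩ := exists_isMinimalNormalIn hN1
        have := hasch G A N L (hL.aschbacherCore hA htop hN hmin
          (centralizer_eq_bot_of_inf_eq_bot hp hA htop hN hfaith hinf)) hcard
        exact TrivialH1.of_simplyConnectedSpace
    · push Not at hfaith
      obtain ⟨a, ha, hc, ha1⟩ := hfaith
      refine trivialH1_apSet_of_central ha1 (hA.pow_eq_one ha) fun x => ?_
      have hle : (⊤ : Subgroup G) ≤ Subgroup.centralizer {a} := by
        rw [← htop]
        exact sup_le (fun b hb => Subgroup.mem_centralizer_singleton_iff.2 (hA.comm hb ha))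
          fun n hn => Subgroup.mem_centralizer_singleton_iff.2 (hc n hn).symm
      exact (Subgroup.mem_centralizer_singleton_iff.1 (hle (Subgroup.mem_top x))).symm

end

/-! ### Fundamental groups of joins -/

section

variable {P Q : Type} [PartialOrder P] [PartialOrder Q]

theorem exists_mulEquiv_freeGroup_lex_of_left [Nonempty P] (hP : ∀ x y : P, x ≤ y → x = y)
    (f : ↥(geomRealOn (Set.univ : Set (P ⊕ₗ Q)))) :
    ∃ S : Type, Nonempty (FundamentalGroup _ f ≃* FreeGroup S) := by
  obtain ⟨d⟩ := ‹Nonempty P›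
  refine (starCover (Set.univ : Set (P ⊕ₗ Q))).exists_mulEquiv_freeGroup_of_discrete
    {v | ∃ x : P, v.1 = toLex (Sum.inl x)} (d₀ := ⟨toLex (Sum.inl d), trivial⟩) ⟨d, rfl⟩ ?_ ?_ f
  · rintro ⟨_, _⟩ ⟨x, rfl⟩ ⟨_, _⟩ ⟨y, rfl⟩ h
    rcases starCover_meet_iff.1 h with h | h
    · rw [Subtype.mk.injEq, hP x y (Sum.Lex.inl_le_inl_iff.1 h)]
    · rw [Subtype.mk.injEq, hP y x (Sum.Lex.inl_le_inl_iff.1 h)]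
  · rintro ⟨_, _⟩ ⟨x, rfl⟩ ⟨v, _⟩ hv
    refine starCover_meet_iff.2 (.inl ?_)
    induction v using Lex.rec with | _ v => ?_
    rcases v with y | y
    · exact absurd ⟨y, rfl⟩ hv
    · exact Sum.Lex.inl_le_inr x y

theorem exists_mulEquiv_freeGroup_lex_of_right [Nonempty Q] (hQ : ∀ x y : Q, x ≤ y → x = y)
    (f : ↥(geomRealOn (Set.univ : Set (P ⊕ₗ Q)))) :
    ∃ S : Type, Nonempty (FundamentalGroup _ f ≃* FreeGroup S) := by
  obtain ⟨d⟩ := ‹Nonempty Q›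
  refine (starCover (Set.univ : Set (P ⊕ₗ Q))).exists_mulEquiv_freeGroup_of_discrete
    {v | ∃ x : Q, v.1 = toLex (Sum.inr x)} (d₀ := ⟨toLex (Sum.inr d), trivial⟩) ⟨d, rfl⟩ ?_ ?_ f
  · rintro ⟨_, _⟩ ⟨x, rfl⟩ ⟨_, _⟩ ⟨y, rfl⟩ h
    rcases starCover_meet_iff.1 h with h | h
    · rw [Subtype.mk.injEq, hQ x y (Sum.Lex.inr_le_inr_iff.1 h)]
    · rw [Subtype.mk.injEq, hQ y x (Sum.Lex.inr_le_inr_iff.1 h)]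
  · rintro ⟨_, _⟩ ⟨x, rfl⟩ ⟨v, _⟩ hv
    refine starCover_meet_iff.2 (.inr ?_)
    induction v using Lex.rec with | _ v => ?_
    rcases v with y | y
    · exact Sum.Lex.inl_le_inr y x
    · exact absurd ⟨y, rfl⟩ hv

theorem exists_eq_toLex_inl {P Q : Type} [IsEmpty Q] (v : P ⊕ₗ Q) : ∃ x : P, toLex (Sum.inl x) = v := by
  induction v using Lex.rec with | _ v => ?_
  rcases v with x | y
  · exact ⟨x, rfl⟩
  · exact isEmptyElim y

theorem exists_mulEquiv_freeGroup_lex_of_isEmpty [IsEmpty Q]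
    (hP : ∀ x y z : P, x ≤ y → y ≤ z → x = y ∨ y = z)
    (f : ↥(geomRealOn (Set.univ : Set (P ⊕ₗ Q)))) :
    ∃ S : Type, Nonempty (FundamentalGroup _ f ≃* FreeGroup S) := by
  refine (starCover (Set.univ : Set (P ⊕ₗ Q))).exists_mulEquiv_freeGroup_of_graph ?_ f
  rintro ⟨u, _⟩ ⟨v, _⟩ ⟨w, _⟩ huv hvw huw
  obtain ⟨x, rfl⟩ := exists_eq_toLex_inl u
  obtain ⟨y, rfl⟩ := exists_eq_toLex_inl v
  obtain ⟨z, rfl⟩ := exists_eq_toLex_inl w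
  rw [starCover_meet_iff, Sum.Lex.inl_le_inl_iff, Sum.Lex.inl_le_inl_iff] at huv hvw huw
  suffices x = y ∨ y = z ∨ x = z by
    rcases this with rfl | rfl | rfl <;> simp
  rcases huv with h1 | h1 <;> rcases hvw with h2 | h2 <;> rcases huw with h3 | h3 <;> grind

theorem TrivialH1.lex_of_isEmpty {X : Type} [PartialOrder X] {S : Set X} [Nonempty ↥S] [IsEmpty Q]
    (h : TrivialH1 S) : TrivialH1 (Set.univ : Set (↥S ⊕ₗ Q)) := by
  classical
  obtain ⟨d⟩ := ‹Nonempty ↥S›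
  refine h.of_retract (fun v => Sum.elim (fun x : ↥S => (x : X)) isEmptyElim (ofLex v))
    (fun x => toLex (Sum.inl (if hx : x ∈ S then ⟨x, hx⟩ else d))) ?_ (fun _ _ => trivial) ?_ ?_ ?_
  · intro v _
    obtain ⟨x, rfl⟩ := exists_eq_toLex_inl v
    exact x.2
  · intro v _ w _ hvw
    obtain ⟨x, rfl⟩ := exists_eq_toLex_inl v
    obtain ⟨y, rfl⟩ := exists_eq_toLex_inl w
    exact (Sum.Lex.inl_le_inl_iff.1 hvw : x ≤ y)
  · intro x hx y hy hxy
    rw [dif_pos hx, dif_pos hy]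
    exact Sum.Lex.inl_le_inl_iff.2 hxy
  · intro v _
    obtain ⟨x, rfl⟩ := exists_eq_toLex_inl v
    simp

end

section

variable {G : Type} [Group G] {p : ℕ}

theorem card_le_of_mem_apSetIn [Finite G] (hp : p.Prime) {A N H : Subgroup G} [N.Normal]
    (hA : IsElementaryAbelian p ↥A) (hN : ¬ p ∣ Nat.card ↥N) (hH : H ∈ apSetIn p (A ⊔ N)) :
    Nat.card ↥H ≤ Nat.card ↥A := by
  obtain ⟨k, -, hk⟩ := exists_le_conjSub hp hA.isPGroup hN Subgroup.le_normalizer_of_normal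
    hH.2.1.isPGroup hH.2.2
  rw [← card_conjSub k A]
  exact Subgroup.card_le_of_le hk

end

/-- Let `N ⊴ G` have order prime to `p`, let `A ∈ A_p(G)` have rank
at most 3 and set `Ā = AN/N`. Assuming Aschbacher's conjecture at `p` in rank 3, the
fundamental group of the realization of `K(A_p(AN) * A_p(G/N)²_{>Ā})` is free if
`|A| = p` or `|A| = p²`, and trivial if `|A| = p³`. -/
theorem stmt11 (G : Type) [Group G] [Finite G] (p : ℕ) (hp : p.Prime)
    (N : Subgroup G) [N.Normal] (hN : ¬ p ∣ Nat.card ↥N)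
    (hasch : AschbacherConjectureRank3 p)
    (A : Subgroup G) (hA : A ∈ apSet p G)
    (hrank : ∃ r : ℕ, 1 ≤ r ∧ r ≤ 3 ∧ Nat.card ↥A = p ^ r) :
    ((Nat.card ↥A = p ∨ Nat.card ↥A = p ^ 2) →
      ∀ x : ↥(geomRealOn
          (Set.univ : Set (quillenJoin p G N A (A.map (QuotientGroup.mk' N))))),
        ∃ S : Type, Nonempty (FundamentalGroup
          ↥(geomRealOn
            (Set.univ : Set (quillenJoin p G N A (A.map (QuotientGroup.mk' N))))) x ≃*
          FreeGroup S)) ∧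
    (Nat.card ↥A = p ^ 3 →
      ∀ x : ↥(geomRealOn
          (Set.univ : Set (quillenJoin p G N A (A.map (QuotientGroup.mk' N))))),
        Subsingleton (FundamentalGroup
          ↥(geomRealOn
            (Set.univ : Set (quillenJoin p G N A (A.map (QuotientGroup.mk' N))))) x)) := by
  have := Fact.mk hp
  obtain ⟨hA1, hAE⟩ := hA
  have hcardmap : Nat.card ↥(A.map (QuotientGroup.mk' N)) = Nat.card ↥A :=
    card_map_mk'_of_inf_eq_bot (disjoint_of_isPGroup_of_not_dvd hp hAE.isPGroup hN)
  have hlt : ∀ {K : Type} [Group K] [Finite K] {x y : Subgroup K}, x < y →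
      Nat.card ↥x < Nat.card ↥y := fun h => Set.Finite.card_lt_card (Set.toFinite _) h
  have : Nonempty ↥(apSetIn p (A ⊔ N)) := ⟨⟨A, hA1, hAE, le_sup_left⟩⟩
  refine ⟨?_, fun hcard f => ?_⟩
  · rintro (hcard | hcard) f
    · refine exists_mulEquiv_freeGroup_lex_of_left (fun x y hxy => ?_) f
      by_contra hne
      have h := sq_le_card_of_lt hp x.2.1 y.2.2.1.isPGroup
        (lt_of_le_of_ne hxy (fun h => hne (Subtype.ext h)))
      have h' := card_le_of_mem_apSetIn hp hAE hN y.2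
      rw [hcard] at h'
      nlinarith [hp.two_le]
    · rcases isEmpty_or_nonempty
        ↥{H | H ∈ apSetN p (G ⧸ N) 2 ∧ A.map (QuotientGroup.mk' N) < H} with hQ | hQ
      · refine exists_mulEquiv_freeGroup_lex_of_isEmpty (fun x y z hxy hyz => ?_) f
        by_contra! hne
        have h := sq_le_card_of_lt hp x.2.1 y.2.2.1.isPGroup
          (lt_of_le_of_ne hxy (fun h => hne.1 (Subtype.ext h)))
        have h' := card_le_of_mem_apSetIn hp hAE hN z.2
        have h'' := hlt (lt_of_le_of_ne hyz (fun h => hne.2 (Subtype.ext h)))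
        omega
      · refine exists_mulEquiv_freeGroup_lex_of_right (fun x y hxy => ?_) f
        by_contra hne
        have h1 := hlt (lt_of_le_of_ne hxy (fun h => hne (Subtype.ext h)))
        have h2 := hlt x.2.2
        have h3 := y.2.1.2
        obtain ⟨k, hk⟩ := x.2.1.1.2.isPGroup.exists_card_eq
        rw [hk] at h1 h2
        rw [hcardmap, hcard, Nat.pow_lt_pow_iff_right hp.one_lt] at h2
        have := (Nat.pow_lt_pow_iff_right hp.one_lt).1 (h1.trans_le h3)
        omega
  · have hQ : IsEmpty ↥{H | H ∈ apSetN p (G ⧸ N) 2 ∧ A.map (QuotientGroup.mk' N) < H} := by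
      refine ⟨fun x => ?_⟩
      have h := hlt x.2.2
      rw [hcardmap, hcard] at h
      exact absurd h (not_lt.2 x.2.1.2)
    have h := (trivialH1Below hp hasch _).trivialH1_apSetIn (Nat.lt_succ_self _) hAE hcard hN
    exact h.lex_of_isEmpty.subsingleton_fundamentalGroup f
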